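/- arXiv:2402.10656 — 5 statements merged into one kernel-verified Lean document; each statement's English description precedes it below -/
import Mathlib

section
/- Let k ≥ 3 be an integer. There exists a constant R_k > 0, depending only on k, such that for every bounded open interval I, every function u that is k times continuously differentiable on a neighbourhood of the closure of I, every integer ℓ with 2 ≤ ℓ ≤ k−1 and every ε ∈ (0,1), one has ε^{γ_ℓ} ∫_I (u^{(ℓ)})² dt ≤ R_k ( ∫_I (u')² dt + ε^{2k−1} ∫_I (u^{(k)})² dt + (ε^{γ_ℓ} / |I|^{2(ℓ−1)}) ∫_I (u')² dt ), where γ_ℓ = (2k−1)(ℓ−1)/(k−1). -/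
open MeasureTheory Set

lemma aux_endpoint {a b h α c : ℝ} (hab : a < b) (hh : 0 < h) (hL : h ≤ b - a) (hα : 0 < α)
    (hc : c = a ∨ c = b) {f f1 : ℝ → ℝ} (hf : ∀ x ∈ Icc a b, HasDerivAt f (f1 x) x)
    (hf1 : ContinuousOn f1 (Icc a b)) :
    (∃ d, (d = a ∨ d = b) ∧ d ≠ c ∧ f d ^ 2 ≤ (1 / h + α) * (∫ t in a..b, f t ^ 2) +
      (∫ t in a..b, f1 t ^ 2) / α) := by
  have hI : uIcc a b = Icc a b := uIcc_of_le hab.le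
  have hfc : ContinuousOn f (Icc a b) := fun x hx => (hf x hx).continuousAt.continuousWithinAt
  have hL0 : 0 < b - a := by linarith
  have key : ∫ t in a..b, (f t ^ 2 + (t - c) * (2 * f t * f1 t)) =
      (b - c) * f b ^ 2 - (a - c) * f a ^ 2 := by
    apply intervalIntegral.integral_eq_sub_of_hasDerivAt (f := fun t => (t - c) * f t ^ 2)
    · intro x hx
      rw [hI] at hx
      have := ((hasDerivAt_id x).sub_const c).mul ((hf x hx).pow 2)
      refine HasDerivAt.congr_deriv (f := fun t => (t - c) * f t ^ 2) this ?_
      simp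
    · apply ContinuousOn.intervalIntegrable
      rw [hI]; fun_prop
  have hi0 : IntervalIntegrable (fun t => f t ^ 2) volume a b := by
    apply ContinuousOn.intervalIntegrable; rw [hI]; fun_prop
  have hi1 : IntervalIntegrable (fun t => f1 t ^ 2) volume a b := by
    apply ContinuousOn.intervalIntegrable; rw [hI]; fun_prop
  have le : ∫ t in a..b, (f t ^ 2 + (t - c) * (2 * f t * f1 t)) ≤
      ∫ t in a..b, ((1 + (b - a) * α) * f t ^ 2 + ((b - a) / α) * f1 t ^ 2) := by
    apply intervalIntegral.integral_mono_on hab.le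
    · apply ContinuousOn.intervalIntegrable
      rw [hI]; fun_prop
    · exact (hi0.const_mul _).add (hi1.const_mul _)
    · intro t ht
      have h1 : |t - c| ≤ b - a := by
        rw [abs_le]; rcases hc with rfl | rfl <;> constructor <;> linarith [ht.1, ht.2]
      have h2 : |2 * f t * f1 t| ≤ α * f t ^ 2 + f1 t ^ 2 / α := by
        have e1 : α * f t ^ 2 + f1 t ^ 2 / α - 2 * f t * f1 t = (α * f t - f1 t) ^ 2 / α := by
          field_simp; ring
        have e2 : α * f t ^ 2 + f1 t ^ 2 / α + 2 * f t * f1 t = (α * f t + f1 t) ^ 2 / α := by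
          field_simp; ring
        have p1 : 0 ≤ (α * f t - f1 t) ^ 2 / α := by positivity
        have p2 : 0 ≤ (α * f t + f1 t) ^ 2 / α := by positivity
        rw [abs_le]; constructor <;> linarith
      have h3 : (t - c) * (2 * f t * f1 t) ≤ (b - a) * (α * f t ^ 2 + f1 t ^ 2 / α) := by
        refine (le_abs_self _).trans ?_
        rw [abs_mul]
        exact mul_le_mul h1 h2 (abs_nonneg _) hL0.le
      have e : (b - a) / α * f1 t ^ 2 = (b - a) * (f1 t ^ 2 / α) := by ring
      rw [e]; linarith
  rw [key, intervalIntegral.integral_add (hi0.const_mul _) (hi1.const_mul _),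
    intervalIntegral.integral_const_mul, intervalIntegral.integral_const_mul] at le
  set N0 := ∫ t in a..b, f t ^ 2 with hN0
  set N1 := ∫ t in a..b, f1 t ^ 2
  have N0p : 0 ≤ N0 := intervalIntegral.integral_nonneg hab.le (fun _ _ => sq_nonneg _)
  have fin : ∀ y : ℝ, (b - a) * y ≤ (1 + (b - a) * α) * N0 + (b - a) / α * N1 →
      y ≤ (1 / h + α) * N0 + N1 / α := by
    intro y hy
    have h4 : y ≤ (1 / (b - a) + α) * N0 + N1 / α := by
      rw [← mul_le_mul_iff_right₀ hL0]
      refine hy.trans (le_of_eq ?_)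
      field_simp
    have h5 : 1 / (b - a) ≤ 1 / h := one_div_le_one_div_of_le hh hL
    nlinarith
  rcases hc with rfl | rfl
  · exact ⟨b, Or.inr rfl, hab.ne', fin _ (by linarith)⟩
  · exact ⟨a, Or.inl rfl, hab.ne, fin _ (by linarith)⟩

lemma aux_base {a b h : ℝ} (hab : a < b) (hh : 0 < h) (hL : h ≤ b - a)
    {f f1 f2 : ℝ → ℝ} (hf : ∀ x ∈ Icc a b, HasDerivAt f (f1 x) x)
    (hf1 : ∀ x ∈ Icc a b, HasDerivAt f1 (f2 x) x)
    (hf2 : ContinuousOn f2 (Icc a b)) :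
    (∫ t in a..b, f1 t ^ 2) ≤ 529 * ((∫ t in a..b, f t ^ 2) / h ^ 2 +
      h ^ 2 * (∫ t in a..b, f2 t ^ 2)) := by
  have hI : uIcc a b = Icc a b := uIcc_of_le hab.le
  have hfc : ContinuousOn f (Icc a b) := fun x hx => (hf x hx).continuousAt.continuousWithinAt
  have hfc1 : ContinuousOn f1 (Icc a b) := fun x hx => (hf1 x hx).continuousAt.continuousWithinAt
  have hi0 : IntervalIntegrable (fun t => f t ^ 2) volume a b := by
    apply ContinuousOn.intervalIntegrable; rw [hI]; fun_prop
  have hi1 : IntervalIntegrable (fun t => f1 t ^ 2) volume a b := by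
    apply ContinuousOn.intervalIntegrable; rw [hI]; fun_prop
  have hi2 : IntervalIntegrable (fun t => f2 t ^ 2) volume a b := by
    apply ContinuousOn.intervalIntegrable; rw [hI]; fun_prop
  have hi02 : IntervalIntegrable (fun t => f t * f2 t) volume a b := by
    apply ContinuousOn.intervalIntegrable; rw [hI]; fun_prop
  have key : ∫ t in a..b, (f1 t ^ 2 + f t * f2 t) = f b * f1 b - f a * f1 a := by
    apply intervalIntegral.integral_eq_sub_of_hasDerivAt (f := fun t => f t * f1 t)
    · intro x hx
      rw [hI] at hx
      have := (hf x hx).mul (hf1 x hx)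
      refine HasDerivAt.congr_deriv (f := fun t => f t * f1 t) this ?_
      ring
    · exact hi1.add hi02
  rw [intervalIntegral.integral_add hi1 hi02] at key
  have le : ∫ t in a..b, -(f t * f2 t) ≤
      ∫ t in a..b, ((1 / (2 * h ^ 2)) * f t ^ 2 + (h ^ 2 / 2) * f2 t ^ 2) := by
    apply intervalIntegral.integral_mono_on hab.le hi02.neg
      ((hi0.const_mul _).add (hi2.const_mul _))
    intro t _
    change -(f t * f2 t) ≤ _
    have e : (1 / (2 * h ^ 2)) * f t ^ 2 + (h ^ 2 / 2) * f2 t ^ 2 - -(f t * f2 t) =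
      (f t / h + h * f2 t) ^ 2 / 2 := by field_simp; ring
    have : 0 ≤ (f t / h + h * f2 t) ^ 2 / 2 := by positivity
    linarith
  rw [intervalIntegral.integral_neg, intervalIntegral.integral_add (hi0.const_mul _)
    (hi2.const_mul _), intervalIntegral.integral_const_mul,
    intervalIntegral.integral_const_mul] at le
  have ends : ∀ d, (d = a ∨ d = b) → |f d * f1 d| ≤
      132 * ((∫ t in a..b, f t ^ 2) / h ^ 2) + (∫ t in a..b, f1 t ^ 2) / 4 +
        (h ^ 2 * (∫ t in a..b, f2 t ^ 2)) / 16 := by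
    intro d hd
    obtain ⟨c, hc, hcd⟩ : ∃ c, (c = a ∨ c = b) ∧ d ≠ c := by
      rcases hd with rfl | rfl
      · exact ⟨b, Or.inr rfl, hab.ne⟩
      · exact ⟨a, Or.inl rfl, hab.ne'⟩
    obtain ⟨d1, hd1, hdc1, A⟩ := aux_endpoint hab hh hL (α := 32 / h) (by positivity) hc hf hfc1
    obtain ⟨d2, hd2, hdc2, B⟩ := aux_endpoint hab hh hL (α := 1 / h) (by positivity) hc hf1 hf2
    have q1 : d1 = d := by grind
    have q2 : d2 = d := by grind
    subst q1; subst q2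
    set N0 := ∫ t in a..b, f t ^ 2
    set N1 := ∫ t in a..b, f1 t ^ 2
    set N2 := ∫ t in a..b, f2 t ^ 2
    have C : |f d2 * f1 d2| ≤ (4 / h) * f d2 ^ 2 + (h / 16) * f1 d2 ^ 2 := by
      have e1 : (4 / h) * f d2 ^ 2 + (h / 16) * f1 d2 ^ 2 - f d2 * f1 d2 =
        (8 * f d2 - h * f1 d2) ^ 2 / (16 * h) := by field_simp; ring
      have e2 : (4 / h) * f d2 ^ 2 + (h / 16) * f1 d2 ^ 2 + f d2 * f1 d2 =
        (8 * f d2 + h * f1 d2) ^ 2 / (16 * h) := by field_simp; ring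
      have p1 : 0 ≤ (8 * f d2 - h * f1 d2) ^ 2 / (16 * h) := by positivity
      have p2 : 0 ≤ (8 * f d2 + h * f1 d2) ^ 2 / (16 * h) := by positivity
      rw [abs_le]; constructor <;> linarith
    refine C.trans ?_
    have A' := mul_le_mul_of_nonneg_left A (show 0 ≤ 4 / h by positivity)
    have B' := mul_le_mul_of_nonneg_left B (show 0 ≤ h / 16 by positivity)
    refine (add_le_add A' B').trans (le_of_eq ?_)
    field_simp
    ring
  have Ea := abs_le.1 (ends a (Or.inl rfl))
  have Eb := abs_le.1 (ends b (Or.inr rfl))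
  set N0 := ∫ t in a..b, f t ^ 2
  set N1 := ∫ t in a..b, f1 t ^ 2
  set N2 := ∫ t in a..b, f2 t ^ 2
  have p0 : 0 ≤ N0 / h ^ 2 := div_nonneg
    (intervalIntegral.integral_nonneg hab.le (fun _ _ => sq_nonneg _)) (by positivity)
  have p2 : 0 ≤ h ^ 2 * N2 := mul_nonneg (by positivity)
    (intervalIntegral.integral_nonneg hab.le (fun _ _ => sq_nonneg _))
  have e : 1 / (2 * h ^ 2) * N0 = (N0 / h ^ 2) / 2 := by field_simp
  rw [e] at le
  have e2 : h ^ 2 / 2 * N2 = (h ^ 2 * N2) / 2 := by ring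
  rw [e2] at le
  linarith [Ea.1, Eb.2]

lemma aux_seq (K : ℝ) (hK : 1 ≤ K) (j : ℕ) : ∀ η : ℝ, 0 < η → η ≤ 1 → ∃ A : ℝ, 0 ≤ A ∧
    ∀ M : ℕ → ℝ, (∀ i, 0 ≤ M i) →
      (∀ i < j, ∀ η : ℝ, 0 < η → η ≤ 1 → M (i + 1) ≤ K / η * M i + η * M (i + 2)) →
      M j ≤ A * M 0 + η * M (j + 1) := by
  induction j with
  | zero =>
    intro η h0 h1
    refine ⟨1, zero_le_one, fun M hM _ => ?_⟩
    have := mul_nonneg h0.le (hM 1)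
    simpa using this
  | succ j ih =>
    intro η h0 h1
    obtain ⟨A, hA, H⟩ := ih (η / 2 / (2 * K)) (by positivity)
      (by rw [div_le_one (by positivity)]; linarith)
    refine ⟨2 * (K / (η / 2) * A), by positivity, fun M hM hs => ?_⟩
    have a1 := H M hM (fun i hi => hs i (by omega))
    have a2 := hs j (by omega) (η / 2) (by positivity) (by linarith)
    have a3 := mul_le_mul_of_nonneg_left a1 (show 0 ≤ K / (η / 2) by positivity)
    have e : K / (η / 2) * (A * M 0 + η / 2 / (2 * K) * M (j + 1)) =
      K / (η / 2) * A * M 0 + M (j + 1) / 2 := by field_simp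
    rw [e] at a3
    have : j + 1 + 1 = j + 2 := rfl
    rw [this]
    linarith

lemma aux_seq2 (K : ℝ) (hK : 1 ≤ K) (m : ℕ) : ∃ B : ℝ, 1 ≤ B ∧
    ∀ M : ℕ → ℝ, (∀ i, 0 ≤ M i) →
      (∀ i, i + 2 ≤ m → ∀ η : ℝ, 0 < η → η ≤ 1 → M (i + 1) ≤ K / η * M i + η * M (i + 2)) →
      ∀ j ≤ m, M j ≤ B * M 0 + M m := by
  choose A hA H using fun j => aux_seq K hK j 1 one_pos le_rfl
  have S : ∀ n, 0 ≤ ∑ i ∈ Finset.range n, A i := fun n => Finset.sum_nonneg fun i _ => hA i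
  refine ⟨1 + ∑ i ∈ Finset.range m, A i, by linarith [S m], fun M hM hs j hj => ?_⟩
  have T : ∀ n, j + n ≤ m → M j ≤ (∑ i ∈ Finset.range (j + n), A i) * M 0 + M (j + n) := by
    intro n
    induction n with
    | zero => intro _; have := mul_nonneg (S j) (hM 0); simpa using this
    | succ n ih =>
      intro hn
      have a1 := ih (by omega)
      have a2 := H (j + n) M hM (fun i hi => hs i (by omega))
      rw [← add_assoc, Finset.sum_range_succ, add_mul]
      linarith
  have := T (m - j) (by omega)
  rw [Nat.add_sub_cancel' hj] at this
  linarith [hM 0]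

lemma aux_main (m : ℕ) : ∃ B : ℝ, 1 ≤ B ∧ ∀ (N : ℕ → ℝ) (L : ℝ), (∀ i, 0 ≤ N i) → 0 < L →
    (∀ i, i + 2 ≤ m → ∀ h, 0 < h → h ≤ L → N (i + 1) ≤ 529 * (N i / h ^ 2 + h ^ 2 * N (i + 2))) →
    ∀ j ≤ m, ∀ δ : ℝ, 0 < δ → δ ^ (2 * j) * N j ≤
      B * (N 0 + δ ^ (2 * m) * N m + δ ^ (2 * j) / L ^ (2 * j) * N 0) := by
  obtain ⟨B, hB, H⟩ := aux_seq2 (529 ^ 2) (by norm_num) m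
  refine ⟨B, hB, fun N L hN hL hs j hj δ hδ => ?_⟩
  have G : ∀ h, 0 < h → h ≤ L → h ^ (2 * j) * N j ≤ B * N 0 + h ^ (2 * m) * N m := by
    intro h h0 h1
    have := H (fun i => h ^ (2 * i) * N i) (fun i => mul_nonneg (by positivity) (hN i)) ?_ j hj
    · simpa using this
    · intro i hi η e0 e1
      have sq : (h * √(η / 529)) ^ 2 = h ^ 2 * (η / 529) := by
        rw [mul_pow, Real.sq_sqrt (by positivity)]
      have hle : √(η / 529) ≤ 1 := by
        rw [Real.sqrt_le_one]; linarith
      have a := hs i hi (h * √(η / 529)) (by positivity) (by nlinarith)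
      rw [sq] at a
      have a' := mul_le_mul_of_nonneg_left a (show 0 ≤ h ^ (2 * (i + 1)) by positivity)
      refine a'.trans (le_of_eq ?_)
      have x1 : h ^ (2 * (i + 1)) = h ^ (2 * i) * h ^ 2 := by ring
      have x2 : h ^ (2 * (i + 2)) = h ^ (2 * i) * h ^ 2 * h ^ 2 := by ring
      simp only [x1, x2]
      field_simp
  have pm : 0 ≤ δ ^ (2 * m) * N m := mul_nonneg (by positivity) (hN m)
  have pj : 0 ≤ δ ^ (2 * j) / L ^ (2 * j) * N 0 := mul_nonneg (by positivity) (hN 0)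
  rcases le_total δ L with h | h
  · have := G δ hδ h
    nlinarith
  · have a := mul_le_mul_of_nonneg_left (G L hL le_rfl)
      (show 0 ≤ δ ^ (2 * j) / L ^ (2 * j) by positivity)
    have e : δ ^ (2 * j) / L ^ (2 * j) * (L ^ (2 * j) * N j) = δ ^ (2 * j) * N j := by
      field_simp
    rw [e] at a
    have x : L ^ (2 * m) = L ^ (2 * j) * L ^ (2 * (m - j)) := by rw [← pow_add]; congr 1; omega
    have y : δ ^ (2 * m) = δ ^ (2 * j) * δ ^ (2 * (m - j)) := by rw [← pow_add]; congr 1; omega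
    have c : δ ^ (2 * j) / L ^ (2 * j) * (L ^ (2 * m) * N m) ≤ δ ^ (2 * m) * N m := by
      rw [x, y]
      have : δ ^ (2 * j) / L ^ (2 * j) * (L ^ (2 * j) * L ^ (2 * (m - j)) * N m) =
        δ ^ (2 * j) * L ^ (2 * (m - j)) * N m := by field_simp
      rw [this]
      have := hN m
      gcongr
    have := hN 0
    nlinarith

lemma aux_deriv {U : Set ℝ} (hU : IsOpen U) {k : ℕ} {u : ℝ → ℝ} (hu : ContDiffOn ℝ k u U) :
    (∀ i < k, ∀ x ∈ U, HasDerivAt (iteratedDeriv i u) (iteratedDeriv (i + 1) u x) x) ∧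
    (ContinuousOn (iteratedDeriv k u) U) := by
  constructor
  · intro i hi x hx
    have h3 := (hu.differentiableOn_iteratedDerivWithin (m := i) (by exact_mod_cast hi)
      hU.uniqueDiffOn).differentiableAt (hU.mem_nhds hx)
    have h4 : iteratedDeriv i u =ᶠ[nhds x] iteratedDerivWithin i u U := by
      filter_upwards [hU.mem_nhds hx] with y hy using (iteratedDerivWithin_of_isOpen hU hy).symm
    rw [iteratedDeriv_succ]
    exact (h3.congr_of_eventuallyEq h4).hasDerivAt
  · exact (hu.continuousOn_iteratedDerivWithin le_rfl hU.uniqueDiffOn).congr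
      fun x hx => (iteratedDerivWithin_of_isOpen hU hx).symm

/-- the key interpolation inequality (Lemma 4.2).  For `k ≥ 3` there is a
constant `R_k > 0` such that for every bounded open interval `I = (a,b)`, every `u` that is
`k` times continuously differentiable on a neighbourhood of `[a,b]`, every `ℓ` with
`2 ≤ ℓ ≤ k-1` and every `ε ∈ (0,1)`,
`ε^{γ_ℓ} ∫_I (u^{(ℓ)})² ≤ R_k (∫_I (u')² + ε^{2k-1} ∫_I (u^{(k)})² + ε^{γ_ℓ}/|I|^{2(ℓ-1)} ∫_I (u')²)`
where `γ_ℓ = (2k-1)(ℓ-1)/(k-1)`. -/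
theorem interpolation_inequality (k : ℕ) (hk : 3 ≤ k) :
    ∃ R : ℝ, 0 < R ∧
      ∀ (a b : ℝ), a < b →
      ∀ u : ℝ → ℝ, (∃ U : Set ℝ, IsOpen U ∧ Icc a b ⊆ U ∧ ContDiffOn ℝ k u U) →
      ∀ ℓ : ℕ, 2 ≤ ℓ → ℓ ≤ k - 1 →
      ∀ ε : ℝ, ε ∈ Ioo (0:ℝ) 1 →
        ε ^ ((2 * (k:ℝ) - 1) * ((ℓ:ℝ) - 1) / ((k:ℝ) - 1)) *
            ∫ t in Ioo a b, (iteratedDeriv ℓ u t) ^ 2 ≤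
          R * ((∫ t in Ioo a b, (deriv u t) ^ 2) +
            ε ^ (2 * k - 1) * (∫ t in Ioo a b, (iteratedDeriv k u t) ^ 2) +
            ε ^ ((2 * (k:ℝ) - 1) * ((ℓ:ℝ) - 1) / ((k:ℝ) - 1)) / (b - a) ^ (2 * (ℓ - 1)) *
              ∫ t in Ioo a b, (deriv u t) ^ 2) := by
  obtain ⟨B, hB, H⟩ := aux_main (k - 1)
  refine ⟨B, by linarith, fun a b hab u hu ℓ h2 hℓ ε hε => ?_⟩
  obtain ⟨U, hU, hIU, hu⟩ := hu
  obtain ⟨D, Cc⟩ := aux_deriv hU hu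
  have hε0 : 0 < ε := hε.1
  have cont : ∀ i ≤ k, ContinuousOn (iteratedDeriv i u) (Icc a b) := by
    intro i hi
    rcases hi.lt_or_eq with h | rfl
    · exact fun x hx => (D i h x (hIU hx)).continuousAt.continuousWithinAt
    · exact Cc.mono hIU
  have T := H (fun i => ∫ t in a..b, (iteratedDeriv (i + 1) u t) ^ 2) (b - a)
    (fun i => intervalIntegral.integral_nonneg hab.le (fun _ _ => sq_nonneg _)) (by linarith)
    (fun i hi h h0 h1 => aux_base hab h0 h1
      (fun x hx => D (i + 1) (by omega) x (hIU hx))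
      (fun x hx => D (i + 1 + 1) (by omega) x (hIU hx)) (cont _ (by omega)))
    (ℓ - 1) (by omega) (ε ^ ((2 * (k:ℝ) - 1) / (2 * ((k:ℝ) - 1)))) (Real.rpow_pos_of_pos hε0 _)
  have hk1 : ((k - 1 : ℕ) : ℝ) = (k:ℝ) - 1 := by rw [Nat.cast_sub (by omega)]; simp
  have hl1 : ((ℓ - 1 : ℕ) : ℝ) = (ℓ:ℝ) - 1 := by rw [Nat.cast_sub (by omega)]; simp
  have hkpos : (0:ℝ) < (k:ℝ) - 1 := by
    have : (3:ℝ) ≤ k := by exact_mod_cast hk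
    linarith
  have e1 : (ε ^ ((2 * (k:ℝ) - 1) / (2 * ((k:ℝ) - 1)))) ^ (2 * (ℓ - 1)) =
      ε ^ ((2 * (k:ℝ) - 1) * ((ℓ:ℝ) - 1) / ((k:ℝ) - 1)) := by
    rw [← Real.rpow_mul_natCast hε0.le]
    congr 1
    push_cast
    rw [hl1]
    field_simp
  have e2 : (ε ^ ((2 * (k:ℝ) - 1) / (2 * ((k:ℝ) - 1)))) ^ (2 * (k - 1)) = ε ^ (2 * k - 1) := by
    rw [← Real.rpow_mul_natCast hε0.le, ← Real.rpow_natCast]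
    congr 1
    rw [Nat.cast_sub (by omega)]
    push_cast
    rw [hk1]
    field_simp
  rw [e1, e2] at T
  have s1 : ℓ - 1 + 1 = ℓ := by omega
  have s2 : k - 1 + 1 = k := by omega
  simp only [s1, s2, zero_add, iteratedDeriv_one, intervalIntegral.integral_of_le hab.le,
    integral_Ioc_eq_integral_Ioo] at T
  exact T
end

section
/- Let k ≥ 2 and n be integers with 2n ≥ k and 1 ≤ n ≤ k−1. Then the sequence N ↦ m_k^n(N) is nondecreasing in N, m_k^n(N) ≤ m_k^n for all N ≥ 1, and m_k^n(N) converges to m_k^n as N → +∞. As a consequence m_k^n > 0; in particular, for n = k−1, m_k(N) → m_k as N → +∞ and m_k > 0. -/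
open MeasureTheory Set Filter

/-- The set of admissible energies for the approximate surface energy density `m_k^n(M)`:
values `T + ∫_{-T/2}^{T/2} (v^{(k)})²` over `T > 0` and `v` which are `k` times continuously
differentiable on `[-T/2, T/2]` with `v(∓T/2) = ∓1/2` and `|v^{(ℓ)}(±T/2)| ≤ 1/M` for
`ℓ ∈ {1,…,n}`.  `m_k^n(M)` is the infimum of this set. -/
def transSet (k n : ℕ) (M : ℝ) : Set ℝ :=
  {E : ℝ | ∃ T : ℝ, 0 < T ∧ ∃ v : ℝ → ℝ,
    ContDiffOn ℝ k v (Icc (-(T/2)) (T/2)) ∧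
    v (-(T/2)) = -(1/2) ∧ v (T/2) = 1/2 ∧
    (∀ ℓ : ℕ, 1 ≤ ℓ → ℓ ≤ n →
      |iteratedDerivWithin ℓ v (Icc (-(T/2)) (T/2)) (-(T/2))| ≤ 1 / M ∧
      |iteratedDerivWithin ℓ v (Icc (-(T/2)) (T/2)) (T/2)| ≤ 1 / M) ∧
    E = T + ∫ t in Icc (-(T/2)) (T/2),
      (iteratedDerivWithin k v (Icc (-(T/2)) (T/2)) t) ^ 2}

/-- The analogous admissible set with the homogeneous boundary conditions
`v^{(ℓ)}(±T/2) = 0` for `ℓ ∈ {1,…,n}`; `m_k^n` is its infimum. -/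
def transSet0 (k n : ℕ) : Set ℝ :=
  {E : ℝ | ∃ T : ℝ, 0 < T ∧ ∃ v : ℝ → ℝ,
    ContDiffOn ℝ k v (Icc (-(T/2)) (T/2)) ∧
    v (-(T/2)) = -(1/2) ∧ v (T/2) = 1/2 ∧
    (∀ ℓ : ℕ, 1 ≤ ℓ → ℓ ≤ n →
      iteratedDerivWithin ℓ v (Icc (-(T/2)) (T/2)) (-(T/2)) = 0 ∧
      iteratedDerivWithin ℓ v (Icc (-(T/2)) (T/2)) (T/2) = 0) ∧
    E = T + ∫ t in Icc (-(T/2)) (T/2),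
      (iteratedDerivWithin k v (Icc (-(T/2)) (T/2)) t) ^ 2}

open Polynomial in
lemma aux_poly (r n : ℕ) (hn : n ≤ r) (hr : r ≤ 2 * n) :
    ∃ q : ℕ → ℝ[X], (∀ i, q (i+1) = derivative (q i)) ∧
      (∀ x ∈ Icc (0:ℝ) 1, |(q 0).eval x| ≤ 1) ∧ q (r+1) = 0 ∧
      q r = C (r.factorial : ℝ) ∧
      ∀ i, i + n < r → (q i).eval 0 = 0 ∧ (q i).eval 1 = 0 := by
  set Q : ℝ[X] := X ^ (r - n) * (X - C 1) ^ n with hQ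
  have hmon : Q.Monic := (monic_X_pow _).mul ((monic_X_sub_C 1).pow n)
  have hdeg : Q.natDegree = r := by
    rw [hQ, (monic_X_pow _).natDegree_mul ((monic_X_sub_C 1).pow n)]
    simp only [natDegree_pow, natDegree_X, natDegree_X_sub_C]
    omega
  refine ⟨fun i => derivative^[i] Q, ?_, ?_, ?_, ?_, ?_⟩
  · intro i
    exact Function.iterate_succ_apply' _ _ _
  · intro x hx
    simp only [Function.iterate_zero, id, hQ, eval_mul, eval_pow, eval_X, eval_sub, eval_C, abs_mul,
      abs_pow]
    have h1 : |x| ≤ 1 := abs_le.2 ⟨by linarith [hx.1], hx.2⟩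
    have h2 : |x - 1| ≤ 1 := abs_le.2 ⟨by linarith [hx.1], by linarith [hx.2]⟩
    exact mul_le_one₀ (pow_le_one₀ (abs_nonneg _) h1) (by positivity) (pow_le_one₀ (abs_nonneg _) h2)
  · exact iterate_derivative_eq_zero (by omega)
  · ext m
    simp only [coeff_iterate_derivative, coeff_C]
    split_ifs with h
    · subst h
      have : Q.coeff r = 1 := by rw [← hdeg]; exact hmon
      simp [this, Nat.descFactorial_self]
    · rw [coeff_eq_zero_of_natDegree_lt (by omega)]
      simp
  · intro i hi
    constructor
    · have h : (X : ℝ[X]) ^ (r - n - i) ∣ derivative^[i] Q :=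
        pow_sub_dvd_iterate_derivative_of_pow_dvd _ (Dvd.intro _ rfl)
      obtain ⟨g, hg⟩ := h
      simp only [hg, eval_mul, eval_pow, eval_X]
      rw [zero_pow (by omega), zero_mul]
    · have h : (X - C 1 : ℝ[X]) ^ (n - i) ∣ derivative^[i] Q :=
        pow_sub_dvd_iterate_derivative_of_pow_dvd _ (Dvd.intro_left _ rfl)
      obtain ⟨g, hg⟩ := h
      simp only [hg, eval_mul, eval_pow, eval_X, eval_sub, eval_C, sub_self]
      rw [zero_pow (by omega), zero_mul]

lemma aux_T (r n : ℕ) (hn : n ≤ r) (hr : r ≤ 2 * n) (hr1 : 1 ≤ r) :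
    ∃ C : ℝ, 0 ≤ C ∧ ∀ T : ℝ, 0 < T → ∀ v : ℝ → ℝ,
      ContDiffOn ℝ (r+1 : ℕ) v (Icc (-(T/2)) (T/2)) →
      v (-(T/2)) = -(1/2) → v (T/2) = 1/2 →
      (∀ ℓ : ℕ, 1 ≤ ℓ → ℓ ≤ n →
      |iteratedDerivWithin ℓ v (Icc (-(T/2)) (T/2)) (-(T/2))| ≤ 1 ∧
      |iteratedDerivWithin ℓ v (Icc (-(T/2)) (T/2)) (T/2)| ≤ 1) →
      1 ≤ T * (1 + C + (T + ∫ t in Icc (-(T/2)) (T/2),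
        (iteratedDerivWithin (r+1) v (Icc (-(T/2)) (T/2)) t) ^ 2)) := by
  obtain ⟨q, hq1, hq2, hq3, hq4, hq5⟩ := aux_poly r n hn hr
  refine ⟨∑ i ∈ Finset.range r, (|(q i).eval 1| + |(q i).eval 0|), by positivity, ?_⟩
  intro T hT v hv hva hvb hbd
  set C := ∑ i ∈ Finset.range r, (|(q i).eval 1| + |(q i).eval 0|) with hC
  have hC0 : 0 ≤ C := by positivity
  set S := Icc (-(T/2)) (T/2) with hS
  set D : ℕ → ℝ → ℝ := fun j => iteratedDerivWithin j v S with hD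
  have hI0 : 0 ≤ ∫ t in S, (D (r+1) t)^2 := integral_nonneg (fun _ => sq_nonneg _)
  change 1 ≤ T * (1 + C + (T + ∫ t in S, (D (r+1) t)^2))
  rcases le_or_gt 1 T with h1 | h1
  · nlinarith
  have hab : -(T/2) < T/2 := by linarith
  have hU : UniqueDiffOn ℝ S := uniqueDiffOn_Icc hab
  have hDc : ∀ j ≤ r+1, ContinuousOn (D j) S := fun j hj =>
    hv.continuousOn_iteratedDerivWithin (by exact_mod_cast hj) hU
  have hDd : ∀ j ≤ r, ∀ x ∈ Ioo (-(T/2)) (T/2), HasDerivAt (D j) (D (j+1) x) x := by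
    intro j hj x hx
    have hd := hv.differentiableOn_iteratedDerivWithin (m := j) (by exact_mod_cast Nat.lt_succ_of_le hj) hU
    have hd' := (hd x (Ioo_subset_Icc_self hx)).hasDerivWithinAt
    rw [← iteratedDerivWithin_succ] at hd'
    exact hd'.hasDerivAt (Icc_mem_nhds hx.1 hx.2)
  set s : ℝ → ℝ := fun t => (t + T/2)/T with hs
  have hsd : ∀ x, HasDerivAt s (1/T) x := fun x =>
    ((hasDerivAt_id x).add_const (T/2)).div_const T
  have hqd : ∀ i x, HasDerivAt (fun t => (q i).eval (s t)) ((q (i+1)).eval (s x) * (1/T)) x := by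
    intro i x
    rw [hq1]
    exact ((q i).hasDerivAt (s x)).comp x (hsd x)
  set F : ℝ → ℝ := fun t => ∑ i ∈ Finset.range (r+1),
    ((-1)^i * T^(r-i)) * (D (r-i) t * (q i).eval (s t)) with hF
  have hFc : ContinuousOn F S := by
    refine continuousOn_finsetSum _ fun i hi => ?_
    refine continuousOn_const.mul ((hDc _ (by omega)).mul ?_)
    exact fun x _ => (hqd i x).continuousAt.continuousWithinAt
  have hFd : ∀ x ∈ Ioo (-(T/2)) (T/2), HasDerivAt F (T^r * (D (r+1) x * (q 0).eval (s x))) x := by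
    intro x hx
    have h := HasDerivAt.fun_sum (u := Finset.range (r+1)) (x := x)
      (A := fun i t => ((-1)^i * T^(r-i)) * (D (r-i) t * (q i).eval (s t)))
      (A' := fun i => ((-1)^i * T^(r-i)) * (D (r-i+1) x * (q i).eval (s x) +
        D (r-i) x * ((q (i+1)).eval (s x) * (1/T))))
      (fun i hi => ((hDd (r-i) (by omega) x hx).mul (hqd i x)).const_mul _)
    refine h.congr_deriv ?_
    set G : ℕ → ℝ := fun i => (-1)^i * (D (r+1-i) x * (T^(r+1-i)/T) * (q i).eval (s x)) with hG
    have h2 : ∀ i ∈ Finset.range (r+1), ((-1)^i * T^(r-i)) * (D (r-i+1) x * (q i).eval (s x) +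
        D (r-i) x * ((q (i+1)).eval (s x) * (1/T))) = G i - G (i+1) := by
      intro i hi
      have hi' : i ≤ r := by simpa [Nat.lt_succ_iff] using hi
      have e1 : r + 1 - i = r - i + 1 := by omega
      have e2 : r + 1 - (i+1) = r - i := by omega
      simp only [hG, e1, e2, pow_succ]
      field_simp
      ring
    rw [Finset.sum_congr rfl h2, Finset.sum_range_sub']
    simp only [hG, hq3, Polynomial.eval_zero, Nat.sub_zero, pow_succ]
    field_simp
    simp
  have hcont : ContinuousOn (fun x => T^r * (D (r+1) x * (q 0).eval (s x))) S := by
    refine continuousOn_const.mul ((hDc _ le_rfl).mul ?_)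
    exact fun x _ => (hqd 0 x).continuousAt.continuousWithinAt
  have hint := intervalIntegral.integral_eq_sub_of_hasDerivAt_of_le hab.le hFc hFd
    (ContinuousOn.intervalIntegrable_of_Icc hab.le hcont)
  have hsa : s (-(T/2)) = 0 := by simp [hs]
  have hsb : s (T/2) = 1 := by simp only [hs]; field_simp; ring
  have hbdry : 1 - T * C ≤ |F (T/2) - F (-(T/2))| := by
    simp only [hF, hsa, hsb]
    rw [← Finset.sum_sub_distrib, Finset.sum_range_succ]
    have hlast : |((-1)^r * T^(r-r)) * (D (r-r) (T/2) * (q r).eval 1) -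
        ((-1)^r * T^(r-r)) * (D (r-r) (-(T/2)) * (q r).eval 0)| = (r.factorial : ℝ) := by
      have : ((-1)^r * T^(r-r)) * (D (r-r) (T/2) * (q r).eval 1) -
        ((-1)^r * T^(r-r)) * (D (r-r) (-(T/2)) * (q r).eval 0) = (-1)^r * (r.factorial : ℝ) := by
        simp [hD, hq4, hva, hvb]
        ring
      rw [this, abs_mul, abs_pow]
      simp
    have hrest : |∑ i ∈ Finset.range r, (((-1)^i * T^(r-i)) * (D (r-i) (T/2) * (q i).eval 1) -
        ((-1)^i * T^(r-i)) * (D (r-i) (-(T/2)) * (q i).eval 0))| ≤ T * C := by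
      rw [hC, Finset.mul_sum]
      refine (Finset.abs_sum_le_sum_abs _ _).trans (Finset.sum_le_sum fun i hi => ?_)
      have hi' : i < r := by simpa using hi
      by_cases hin : i + n < r
      · rw [(hq5 i hin).1, (hq5 i hin).2]; simp
      · obtain ⟨ha, hb⟩ := hbd (r-i) (by omega) (by omega)
        change |D (r-i) (-(T/2))| ≤ 1 at ha
        change |D (r-i) (T/2)| ≤ 1 at hb
        have hTp : T^(r-i) ≤ T := by
          calc T^(r-i) ≤ T^1 := pow_le_pow_of_le_one hT.le h1.le (by omega)
            _ = T := pow_one T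
        have hTp0 : 0 ≤ T^(r-i) := by positivity
        rw [← mul_sub, abs_mul, abs_mul, abs_pow, abs_pow, abs_neg, abs_one, one_pow, one_mul,
          abs_of_pos hT]
        have : |D (r-i) (T/2) * (q i).eval 1 - D (r-i) (-(T/2)) * (q i).eval 0| ≤
            |(q i).eval 1| + |(q i).eval 0| := by
          refine (abs_sub _ _).trans (add_le_add ?_ ?_)
          · rw [abs_mul]; exact mul_le_of_le_one_left (abs_nonneg _) hb
          · rw [abs_mul]; exact mul_le_of_le_one_left (abs_nonneg _) ha
        exact mul_le_mul hTp this (abs_nonneg _) hT.le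
    have hf : (1:ℝ) ≤ r.factorial := by exact_mod_cast Nat.one_le_iff_ne_zero.2 r.factorial_ne_zero
    set a := ∑ i ∈ Finset.range r, (((-1)^i * T^(r-i)) * (D (r-i) (T/2) * (q i).eval 1) -
        ((-1)^i * T^(r-i)) * (D (r-i) (-(T/2)) * (q i).eval 0))
    set b := ((-1)^r * T^(r-r)) * (D (r-r) (T/2) * (q r).eval 1) -
        ((-1)^r * T^(r-r)) * (D (r-r) (-(T/2)) * (q r).eval 0)
    have : |b| ≤ |a + b| + |a| := by
      have := abs_sub (a+b) a
      simpa using this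
    linarith
  have hcD2 : ContinuousOn (fun t => 1 + (D (r+1) t)^2) S :=
    continuousOn_const.add ((hDc _ le_rfl).pow 2)
  have hup : |F (T/2) - F (-(T/2))| ≤ T * (T + ∫ t in S, (D (r+1) t)^2) := by
    rw [← hint]
    have h3 : ∫ t in (-(T/2))..(T/2), T * (1 + (D (r+1) t)^2) = T * (T + ∫ t in S, (D (r+1) t)^2) := by
      rw [intervalIntegral.integral_const_mul, intervalIntegral.integral_add,
        intervalIntegral.integral_const, intervalIntegral.integral_of_le hab.le,
        ← integral_Icc_eq_integral_Ioc]
      · simp [hS]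
      · simp
      · exact ContinuousOn.intervalIntegrable_of_Icc hab.le ((hDc _ le_rfl).pow 2)
    rw [← h3]
    have := intervalIntegral.norm_integral_le_of_norm_le (μ := volume) hab.le
      (f := fun x => T^r * (D (r+1) x * (q 0).eval (s x))) (g := fun t => T * (1 + (D (r+1) t)^2)) ?_
      (ContinuousOn.intervalIntegrable_of_Icc hab.le (continuousOn_const.mul hcD2))
    · exact this
    · refine Filter.Eventually.of_forall fun t ht => ?_
      have hst : s t ∈ Icc (0:ℝ) 1 := by
        constructor
        · exact div_nonneg (by linarith [ht.1]) hT.le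
        · simp only [hs]; rw [div_le_one hT]; linarith [ht.2]
      have hq0 := hq2 _ hst
      have hTp : T^r ≤ T := by
          calc T^r ≤ T^1 := pow_le_pow_of_le_one hT.le h1.le hr1
            _ = T := pow_one T
      rw [Real.norm_eq_abs, abs_mul, abs_mul, abs_pow, abs_of_pos hT]
      refine mul_le_mul hTp ?_ (by positivity) hT.le
      refine (mul_le_of_le_one_right (abs_nonneg _) hq0).trans ?_
      rw [← sq_abs (D (r+1) t)]
      nlinarith [sq_nonneg (|D (r+1) t| - 1)]
  nlinarith

lemma aux_bump (k ℓ : ℕ) (c : ℝ) (hc : 0 < c) : ∃ φ : ℝ → ℝ, ContDiff ℝ (⊤ : ℕ∞) φ ∧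
    (∀ j, iteratedDeriv j φ 0 = if j = ℓ then 1 else 0) ∧
    (∀ x, c ≤ |x| → ∀ j, iteratedDeriv j φ x = 0) ∧
    ∃ K : ℝ, 0 ≤ K ∧ ∀ x, |iteratedDeriv k φ x| ≤ K := by
  let f : ContDiffBump (0:ℝ) := ⟨c/4, c/2, by linarith, by linarith⟩
  set φ : ℝ → ℝ := fun x => (1/(ℓ.factorial:ℝ)) * (x^ℓ * f x) with hφ
  have hsm : ContDiff ℝ (⊤ : ℕ∞) φ := contDiff_const.mul ((contDiff_id.pow ℓ).mul f.contDiff)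
  have hzero : ∀ x, c ≤ |x| → ∀ j, iteratedDeriv j φ x = 0 := by
    intro x hx j
    have : φ =ᶠ[nhds x] fun _ => 0 := by
      have h1 : ∀ᶠ y in nhds x, c/2 < |y| :=
        (continuous_abs.tendsto x).eventually (lt_mem_nhds (by linarith))
      filter_upwards [h1] with y hy
      have : f y = 0 := f.zero_of_le_dist (by simpa [f] using hy.le)
      simp [hφ, this]
    rw [this.iteratedDeriv_eq]
    simp
  refine ⟨φ, hsm, ?_, hzero, ?_⟩
  · intro j
    have : φ =ᶠ[nhds 0] fun x => (1/(ℓ.factorial:ℝ)) * x^ℓ := by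
      filter_upwards [f.eventuallyEq_one] with y hy
      simp [hφ, hy]
    rw [this.iteratedDeriv_eq, iteratedDeriv_const_mul_field, iteratedDeriv_fun_pow_zero]
    have := Nat.factorial_ne_zero ℓ
    split_ifs
    · field_simp
    · simp
  · have hcs : HasCompactSupport (iteratedDeriv k φ) := by
      refine HasCompactSupport.intro (isCompact_Icc (a := -c) (b := c)) fun x hx => ?_
      refine hzero x ?_ k
      by_contra h
      push Not at h
      exact hx (abs_le.1 h.le)
    obtain ⟨K, hK⟩ := hcs.exists_bound_of_continuous
      (hsm.continuous_iteratedDeriv k (by exact_mod_cast le_top))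
    exact ⟨K, (norm_nonneg _).trans (hK 0), hK⟩

lemma aux_corr (k n : ℕ) (c : ℝ) (hc : 0 < c) : ∃ K : ℝ, 0 ≤ K ∧ ∀ T : ℝ, c ≤ T →
    ∀ ε : ℝ, ∀ a b : ℕ → ℝ, (∀ ℓ, 1 ≤ ℓ → ℓ ≤ n → |a ℓ| ≤ ε ∧ |b ℓ| ≤ ε) →
    ∃ p : ℝ → ℝ, ContDiff ℝ (⊤ : ℕ∞) p ∧ p (-(T/2)) = 0 ∧ p (T/2) = 0 ∧
      (∀ ℓ, 1 ≤ ℓ → ℓ ≤ n → iteratedDeriv ℓ p (-(T/2)) = a ℓ ∧ iteratedDeriv ℓ p (T/2) = b ℓ) ∧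
      ∀ x, |iteratedDeriv k p x| ≤ K * ε := by
  choose φ hsm h0 hz K hK0 hK using fun ℓ => aux_bump k ℓ c hc
  refine ⟨∑ ℓ ∈ Finset.Icc 1 n, (K ℓ + K ℓ), Finset.sum_nonneg fun i _ => by linarith [hK0 i], ?_⟩
  intro T hT ε a b hab
  set p : ℝ → ℝ := fun t => ∑ ℓ ∈ Finset.Icc 1 n,
    (a ℓ * φ ℓ (t + T/2) + b ℓ * φ ℓ (t - T/2)) with hp
  have c1 : ∀ ℓ, ContDiff ℝ (⊤ : ℕ∞) (fun t => a ℓ * φ ℓ (t + T/2)) := fun ℓ =>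
    contDiff_const.mul ((hsm ℓ).comp (contDiff_id.add contDiff_const))
  have c2 : ∀ ℓ, ContDiff ℝ (⊤ : ℕ∞) (fun t => b ℓ * φ ℓ (t - T/2)) := fun ℓ =>
    contDiff_const.mul ((hsm ℓ).comp (contDiff_id.sub contDiff_const))
  have hle : ∀ j : ℕ, (j : WithTop ℕ∞) ≤ ((⊤ : ℕ∞) : WithTop ℕ∞) := fun j => by exact_mod_cast le_top
  have hder : ∀ j x, iteratedDeriv j p x = ∑ ℓ ∈ Finset.Icc 1 n,
    (a ℓ * iteratedDeriv j (φ ℓ) (x + T/2) + b ℓ * iteratedDeriv j (φ ℓ) (x - T/2)) := by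
    intro j x
    rw [hp, iteratedDeriv_fun_sum]
    · refine Finset.sum_congr rfl fun ℓ _ => ?_
      rw [iteratedDeriv_fun_add ((c1 ℓ).of_le (hle j)).contDiffAt ((c2 ℓ).of_le (hle j)).contDiffAt,
        iteratedDeriv_const_mul_field, iteratedDeriv_const_mul_field,
        iteratedDeriv_comp_add_const, iteratedDeriv_comp_sub_const]
    · exact fun ℓ _ => (((c1 ℓ).add (c2 ℓ)).of_le (hle j)).contDiffAt
  have hT0 : 0 < T := hc.trans_le hT
  have hA : ∀ j, iteratedDeriv j p (-(T/2)) = if j ∈ Finset.Icc 1 n then a j else 0 := by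
    intro j
    rw [hder, ← Finset.sum_ite_eq (Finset.Icc 1 n) j a]
    refine Finset.sum_congr rfl fun ℓ _ => ?_
    rw [show -(T/2) + T/2 = 0 by ring, h0, hz ℓ (-(T/2) - T/2) ?_ j]
    · simp
    · rw [show -(T/2) - T/2 = -T by ring, abs_neg, abs_of_pos hT0]; exact hT
  have hB : ∀ j, iteratedDeriv j p (T/2) = if j ∈ Finset.Icc 1 n then b j else 0 := by
    intro j
    rw [hder, ← Finset.sum_ite_eq (Finset.Icc 1 n) j b]
    refine Finset.sum_congr rfl fun ℓ _ => ?_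
    rw [show (T/2) - T/2 = 0 by ring, h0, hz ℓ (T/2 + T/2) ?_ j]
    · simp
    · rw [show (T/2) + T/2 = T by ring, abs_of_pos hT0]; exact hT
  refine ⟨p, ?_, ?_, ?_, ?_, ?_⟩
  · exact ContDiff.sum fun ℓ _ => (c1 ℓ).add (c2 ℓ)
  · simpa using hA 0
  · simpa using hB 0
  · intro ℓ h1 h2
    rw [hA, hB]
    simp [h1, h2]
  · intro x
    rw [hder, Finset.sum_mul]
    refine (Finset.abs_sum_le_sum_abs _ _).trans (Finset.sum_le_sum fun ℓ hl => ?_)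
    have hl' := Finset.mem_Icc.1 hl
    obtain ⟨ha, hb⟩ := hab ℓ hl'.1 hl'.2
    refine (abs_add_le _ _).trans ?_
    rw [abs_mul, abs_mul, add_mul]
    have := mul_le_mul ha (hK ℓ (x + T/2)) (abs_nonneg _) ((abs_nonneg _).trans ha)
    have := mul_le_mul hb (hK ℓ (x - T/2)) (abs_nonneg _) ((abs_nonneg _).trans hb)
    linarith

lemma aux_nonempty (k n : ℕ) : (transSet0 k n).Nonempty := by
  refine ⟨_, 4, by norm_num, fun t => Real.smoothTransition t - 1/2, ?_, ?_, ?_, ?_, rfl⟩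
  · exact ((Real.smoothTransition.contDiff (n := k)).sub contDiff_const).contDiffOn
  · change Real.smoothTransition (-(4/2)) - 1/2 = _
    rw [Real.smoothTransition.zero_of_nonpos (by norm_num)]; norm_num
  · change Real.smoothTransition (4/2) - 1/2 = _
    rw [Real.smoothTransition.one_of_one_le (by norm_num)]; norm_num
  · intro ℓ h1 h2
    have hU : UniqueDiffOn ℝ (Icc (-((4:ℝ)/2)) (4/2)) := uniqueDiffOn_Icc (by norm_num)
    have hs : ∀ x, ContDiffAt ℝ ℓ (fun t => Real.smoothTransition t - 1/2) x := fun x =>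
      ((Real.smoothTransition.contDiff (n := ℓ)).sub contDiff_const).contDiffAt
    rw [iteratedDerivWithin_eq_iteratedDeriv hU (hs _) (by norm_num),
      iteratedDerivWithin_eq_iteratedDeriv hU (hs _) (by norm_num)]
    have hl : ℓ ≠ 0 := by omega
    constructor
    · have : (fun t => Real.smoothTransition t - 1/2) =ᶠ[nhds (-((4:ℝ)/2))] fun _ => -(1/2) := by
        filter_upwards [Iio_mem_nhds (show -((4:ℝ)/2) < 0 by norm_num)] with y hy
        rw [Real.smoothTransition.zero_of_nonpos (le_of_lt hy)]; norm_num
      rw [this.iteratedDeriv_eq]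
      simp [iteratedDeriv_const, hl]
    · have : (fun t => Real.smoothTransition t - 1/2) =ᶠ[nhds ((4:ℝ)/2)] fun _ => (1/2) := by
        filter_upwards [Ioi_mem_nhds (show (1:ℝ) < 4/2 by norm_num)] with y hy
        rw [Real.smoothTransition.one_of_one_le (le_of_lt hy)]; norm_num
      rw [this.iteratedDeriv_eq]
      simp [iteratedDeriv_const, hl]

lemma aux_perturb (k n : ℕ) (c : ℝ) (hc : 0 < c) : ∃ K : ℝ, 0 ≤ K ∧ ∀ M : ℝ, 0 < M →
    ∀ T : ℝ, c ≤ T → ∀ v : ℝ → ℝ,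
      ContDiffOn ℝ k v (Icc (-(T/2)) (T/2)) →
      v (-(T/2)) = -(1/2) → v (T/2) = 1/2 →
      (∀ ℓ : ℕ, 1 ≤ ℓ → ℓ ≤ n →
      |iteratedDerivWithin ℓ v (Icc (-(T/2)) (T/2)) (-(T/2))| ≤ 1/M ∧
      |iteratedDerivWithin ℓ v (Icc (-(T/2)) (T/2)) (T/2)| ≤ 1/M) → n ≤ k →
      ∃ E' ∈ transSet0 k n, E' ≤ (1 + K/M)^2 * (T + ∫ t in Icc (-(T/2)) (T/2),
        (iteratedDerivWithin k v (Icc (-(T/2)) (T/2)) t) ^ 2) := by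
  obtain ⟨K, hK0, hK⟩ := aux_corr k n c hc
  refine ⟨K, hK0, ?_⟩
  intro M hM T hT v hv hva hvb hbd hnk
  obtain ⟨p, hps, hpa, hpb, hpd, hpk⟩ := hK T hT (1/M)
    (fun ℓ => iteratedDerivWithin ℓ v (Icc (-(T/2)) (T/2)) (-(T/2)))
    (fun ℓ => iteratedDerivWithin ℓ v (Icc (-(T/2)) (T/2)) (T/2)) hbd
  have hT0 : 0 < T := hc.trans_le hT
  have hab : -(T/2) < T/2 := by linarith
  set S := Icc (-(T/2)) (T/2) with hS
  have hU : UniqueDiffOn ℝ S := uniqueDiffOn_Icc hab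
  have hle : ∀ j : ℕ, (j : WithTop ℕ∞) ≤ ((⊤ : ℕ∞) : WithTop ℕ∞) := fun j => by exact_mod_cast le_top
  have hpj : ∀ j : ℕ, ContDiff ℝ j p := fun j => hps.of_le (hle j)
  have hd : ∀ j ≤ k, ∀ x ∈ S, iteratedDerivWithin j (v - p) S x =
      iteratedDerivWithin j v S x - iteratedDeriv j p x := by
    intro j hj x hx
    rw [iteratedDerivWithin_sub hx hU ((hv x hx).of_le (by exact_mod_cast hj))
      (hpj j).contDiffAt.contDiffWithinAt,
      iteratedDerivWithin_eq_iteratedDeriv hU (hpj j).contDiffAt hx]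
  have hma : -(T/2) ∈ S := left_mem_Icc.2 hab.le
  have hmb : T/2 ∈ S := right_mem_Icc.2 hab.le
  have hvp : ContDiffOn ℝ k (v - p) S := hv.sub (hpj k).contDiffOn
  refine ⟨_, ⟨T, hT0, v - p, hvp, ?_, ?_, ?_, rfl⟩, ?_⟩
  · simp [hpa, hva]
  · simp [hpb, hvb]
  · intro ℓ h1 h2
    rw [hd ℓ (by omega) _ hma, hd ℓ (by omega) _ hmb, (hpd ℓ h1 h2).1, (hpd ℓ h1 h2).2]
    simp
  · set η := K / M with hη
    have hη0 : 0 ≤ η := by positivity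
    have hcv : ContinuousOn (iteratedDerivWithin k v S) S :=
      hv.continuousOn_iteratedDerivWithin le_rfl hU
    have hcvp : ContinuousOn (iteratedDerivWithin k (v - p) S) S :=
      hvp.continuousOn_iteratedDerivWithin le_rfl hU
    have hi1 : IntegrableOn (fun t => (iteratedDerivWithin k v S t)^2) S :=
      (hcv.pow 2).integrableOn_Icc
    have hmono : ∫ t in S, (iteratedDerivWithin k (v - p) S t)^2 ≤
        ∫ t in S, ((1 + η) * (iteratedDerivWithin k v S t)^2 + (η + η^2)) := by
      refine setIntegral_mono_on (hcvp.pow 2).integrableOn_Icc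
        ((continuousOn_const.mul (hcv.pow 2)).add continuousOn_const).integrableOn_Icc
        measurableSet_Icc fun t ht => ?_
      simp only [hd k le_rfl t ht]
      have hb : |iteratedDeriv k p t| ≤ η := by
        have := hpk t
        rwa [mul_one_div] at this
      obtain ⟨hb1, hb2⟩ := abs_le.1 hb
      set x := iteratedDerivWithin k v S t
      set y := iteratedDeriv k p t
      have hy2 : y^2 ≤ η^2 := sq_le_sq' hb1 hb2
      nlinarith [mul_nonneg (by linarith : 0 ≤ η + y) (sq_nonneg (x+1)),
        mul_nonneg (by linarith : 0 ≤ η - y) (sq_nonneg (x-1))]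
    have hval : ∫ t in S, ((1 + η) * (iteratedDerivWithin k v S t)^2 + (η + η^2)) =
        (1 + η) * (∫ t in S, (iteratedDerivWithin k v S t)^2) + (η + η^2) * T := by
      rw [integral_add (hi1.const_mul _) (by simp [hS]), integral_const_mul]
      simp [hS, hT0.le]
      ring
    rw [hval] at hmono
    have hI0 : 0 ≤ ∫ t in S, (iteratedDerivWithin k v S t)^2 := integral_nonneg (fun _ => sq_nonneg _)
    nlinarith [mul_nonneg hη0 hI0, mul_nonneg hη0 hT0.le, mul_nonneg (mul_nonneg hη0 hη0) hI0]

/-- Lemma 2.6 of the paper: for `k ≥ 2`, `2n ≥ k`, `1 ≤ n ≤ k-1`,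
the map `N ↦ m_k^n(N)` is nondecreasing, `m_k^n(N) ≤ m_k^n` for `N ≥ 1`,
`m_k^n(N) → m_k^n` as `N → ∞`, and consequently `m_k^n > 0`.
For `n = k-1` this gives `m_k(N) → m_k` and `m_k > 0`. -/
theorem convergence_of_approximate_energy_densities (k n : ℕ) (hk : 2 ≤ k)
    (hkn : k ≤ 2 * n) (hn1 : 1 ≤ n) (hn2 : n ≤ k - 1) :
    (∀ M₁ M₂ : ℝ, 1 ≤ M₁ → M₁ ≤ M₂ → sInf (transSet k n M₁) ≤ sInf (transSet k n M₂)) ∧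
    (∀ M : ℝ, 1 ≤ M → sInf (transSet k n M) ≤ sInf (transSet0 k n)) ∧
    Tendsto (fun N : ℕ => sInf (transSet k n (N : ℝ))) atTop (nhds (sInf (transSet0 k n))) ∧
    0 < sInf (transSet0 k n) := by
  have hbdd : ∀ M, BddBelow (transSet k n M) := by
    intro M
    refine ⟨0, ?_⟩
    rintro E ⟨T, hT, v, -, -, -, -, rfl⟩
    have : 0 ≤ ∫ t in Icc (-(T/2)) (T/2),
      (iteratedDerivWithin k v (Icc (-(T/2)) (T/2)) t) ^ 2 := integral_nonneg (fun _ => sq_nonneg _)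
    linarith
  have hne0 := aux_nonempty k n
  have hsub0 : ∀ M : ℝ, 1 ≤ M → transSet0 k n ⊆ transSet k n M := by
    rintro M hM E ⟨T, hT, v, h1, h2, h3, h4, h5⟩
    refine ⟨T, hT, v, h1, h2, h3, fun ℓ hl hl' => ?_, h5⟩
    rw [(h4 ℓ hl hl').1, (h4 ℓ hl hl').2, abs_zero]
    exact ⟨by positivity, by positivity⟩
  have hsub : ∀ M₁ M₂ : ℝ, 1 ≤ M₁ → M₁ ≤ M₂ → transSet k n M₂ ⊆ transSet k n M₁ := by
    rintro M₁ M₂ hM hMM E ⟨T, hT, v, h1, h2, h3, h4, h5⟩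
    have : 1 / M₂ ≤ 1 / M₁ := one_div_le_one_div_of_le (by linarith) hMM
    exact ⟨T, hT, v, h1, h2, h3, fun ℓ hl hl' =>
      ⟨(h4 ℓ hl hl').1.trans this, (h4 ℓ hl hl').2.trans this⟩, h5⟩
  have hle0 : ∀ M : ℝ, 1 ≤ M → sInf (transSet k n M) ≤ sInf (transSet0 k n) := fun M hM =>
    csInf_le_csInf (hbdd M) hne0 (hsub0 M hM)
  obtain ⟨r, rfl⟩ : ∃ r, k = r + 1 := ⟨k - 1, by omega⟩
  obtain ⟨C, hC0, hC⟩ := aux_T r n (by omega) (by omega) (by omega)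
  have hTE : ∀ M : ℝ, 1 ≤ M → ∀ E ∈ transSet (r+1) n M, 1 ≤ E * (1 + C + E) := by
    rintro M hM E ⟨T, hT, v, h1, h2, h3, h4, rfl⟩
    have hM1 : 1 / M ≤ 1 := by rw [div_le_one (by linarith)]; exact hM
    have h := hC T hT v h1 h2 h3 (fun ℓ hl hl' =>
      ⟨(h4 ℓ hl hl').1.trans hM1, (h4 ℓ hl hl').2.trans hM1⟩)
    have hI : 0 ≤ ∫ t in Icc (-(T/2)) (T/2),
      (iteratedDerivWithin (r+1) v (Icc (-(T/2)) (T/2)) t) ^ 2 := integral_nonneg (fun _ => sq_nonneg _)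
    exact h.trans (mul_le_mul_of_nonneg_right (by linarith) (by linarith))
  have hpos : 0 < sInf (transSet0 (r+1) n) := by
    have : 1 / (2 + C) ≤ sInf (transSet0 (r+1) n) := by
      refine le_csInf hne0 fun E hE => ?_
      have h := hTE 1 le_rfl E (hsub0 1 le_rfl hE)
      have hE0 : 0 ≤ E := by
        obtain ⟨T, hT, v, -, -, -, -, rfl⟩ := hE
        have : 0 ≤ ∫ t in Icc (-(T/2)) (T/2),
          (iteratedDerivWithin (r+1) v (Icc (-(T/2)) (T/2)) t) ^ 2 := integral_nonneg (fun _ => sq_nonneg _)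
        linarith
      rw [div_le_iff₀ (by linarith)]
      rcases le_or_gt E 1 with h1 | h1
      · nlinarith
      · nlinarith
    exact lt_of_lt_of_le (by positivity) this
  refine ⟨fun M₁ M₂ h1 h2 => csInf_le_csInf (hbdd M₁) (hne0.mono (hsub0 M₂ (h1.trans h2)))
    (hsub M₁ M₂ h1 h2), hle0, ?_, hpos⟩
  set m := sInf (transSet0 (r+1) n) with hm
  have hbdd0 : BddBelow (transSet0 (r+1) n) := (hbdd 1).mono (hsub0 1 le_rfl)
  have hc : 0 < 1 / (1 + C + (m + 1)) := by positivity
  obtain ⟨K, hK0, hK⟩ := aux_perturb (r+1) n _ hc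
  have hlow : ∀ N : ℕ, 1 ≤ N → m - ((1 + K/(N:ℝ))^2 - 1) * (m+1) ≤ sInf (transSet (r+1) n (N:ℝ)) := by
    intro N hN
    have hN' : (1:ℝ) ≤ N := by exact_mod_cast hN
    refine le_csInf (hne0.mono (hsub0 _ hN')) ?_
    rintro E hE
    have hη : 0 ≤ K/(N:ℝ) := by positivity
    have hη2 : 0 ≤ (1 + K/(N:ℝ))^2 - 1 := by nlinarith
    rcases le_or_gt E (m+1) with hEm | hEm
    · obtain ⟨T, hT, v, h1, h2, h3, h4, rfl⟩ := hE
      have hM1 : 1 / (N:ℝ) ≤ 1 := by rw [div_le_one (by linarith)]; exact hN'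
      have h := hC T hT v h1 h2 h3 (fun ℓ hl hl' =>
        ⟨(h4 ℓ hl hl').1.trans hM1, (h4 ℓ hl hl').2.trans hM1⟩)
      have hTc : 1 / (1 + C + (m + 1)) ≤ T := by
        rw [div_le_iff₀ (by linarith)]
        exact h.trans (mul_le_mul_of_nonneg_left (by linarith) hT.le)
      obtain ⟨E', hE', hle⟩ := hK N (by linarith) T hTc v h1 h2 h3 h4 (by omega)
      have hmE := csInf_le hbdd0 hE'
      nlinarith [mul_le_mul_of_nonneg_left hEm hη2]
    · nlinarith [mul_nonneg hη2 (by linarith : 0 ≤ m + 1)]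
  have hlim : Tendsto (fun N : ℕ => m - ((1 + K/(N:ℝ))^2 - 1) * (m+1)) atTop (nhds m) := by
    have h := ((((tendsto_const_div_atTop_nhds_zero_nat K).const_add 1).pow 2).sub_const 1).mul_const (m+1)
    have := h.const_sub m
    simpa using this
  refine tendsto_of_tendsto_of_tendsto_of_le_of_le' hlim tendsto_const_nhds ?_ ?_
  · filter_upwards [eventually_ge_atTop 1] with N hN using hlow N hN
  · filter_upwards [eventually_ge_atTop 1] with N hN using hle0 N (by exact_mod_cast hN)
end

section
/- Let k ≥ 3 be an integer, S > 0 and N ≥ 1 with 2N²S ≥ 1, and let ε ∈ (0,1). Let I be a bounded open interval with |I| ≤ ε/(2N²S), and let u be k times continuously differentiable on a neighbourhood of the closure of I with F_ε(u; I) ≤ S. Then there do not exist k−1 pairwise disjoint open subintervals (a_1,b_1),…,(a_{k−1},b_{k−1}) of I with a_1 < b_1 ≤ a_2 < b_2 ≤ … ≤ a_{k−1} < b_{k−1} such that for every i ∈ {1,…,k−1}: |u'(t)| < 1/√ε for all t ∈ (a_i,b_i), |u'(a_i)| = |u'(b_i)| = 1/√ε, and the set { t ∈ (a_i,b_i) :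 |u^{(ℓ)}(t)| < 1/(N ε^ℓ) for all ℓ ∈ {2,…,k−1} } has Lebesgue measure zero. -/
open MeasureTheory Set

/-- The localized energy `F_ε(u; (a,b)) = ∫_{(a,b)} min{(u')², 1/ε} + ε^{2k-1} ∫_{(a,b)} (u^{(k)})²`. -/
noncomputable def Fe (k : ℕ) (ε : ℝ) (u : ℝ → ℝ) (a b : ℝ) : ℝ :=
  (∫ t in Ioo a b, min ((deriv u t) ^ 2) (1 / ε)) +
    ε ^ (2 * k - 1) * ∫ t in Ioo a b, (iteratedDeriv k u t) ^ 2

theorem aux_rolle (a b : ℝ) (n : ℕ) : ∀ (f : ℕ → ℝ → ℝ) (z : ℕ → ℝ),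
    (∀ j < n, ∀ x ∈ Icc a b, HasDerivAt (f j) (f (j+1) x) x) →
    (∀ i ≤ n, z i ∈ Icc a b ∧ f 0 (z i) = 0) →
    (∀ i < n, z i < z (i+1)) →
    ∀ j ≤ n, ∃ x ∈ Icc a b, f j x = 0 := by
  induction n with
  | zero =>
    intro f z _ hz _ j hj
    obtain rfl : j = 0 := by omega
    exact ⟨z 0, hz 0 le_rfl⟩
  | succ n ih =>
    intro f z hd hz hlt j hj
    have key : ∀ i, ∃ x, i < n + 1 → (x ∈ Ioo (z i) (z (i+1)) ∧ f 1 x = 0) := by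
      intro i
      by_cases hi : i < n + 1
      · have h1 := hz i (by omega)
        have h2 := hz (i+1) (by omega)
        have hsub : Icc (z i) (z (i+1)) ⊆ Icc a b := Icc_subset_Icc h1.1.1 h2.1.2
        obtain ⟨x, hx, hx0⟩ := exists_hasDerivAt_eq_zero (f := f 0) (f' := f 1) (hlt i hi)
          (fun y hy => (hd 0 (by omega) y (hsub hy)).continuousAt.continuousWithinAt)
          (by rw [h1.2, h2.2])
          (fun y hy => hd 0 (by omega) y (hsub (Ioo_subset_Icc_self hy)))
        exact ⟨x, fun _ => ⟨hx, hx0⟩⟩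
      · exact ⟨0, fun h => absurd h hi⟩
    choose z' hz' using key
    rcases j with _ | j
    · exact ⟨z 0, hz 0 (by omega)⟩
    · refine ih (fun j => f (j+1)) z' (fun j hj x hx => hd (j+1) (by omega) x hx) ?_ ?_ j (by omega)
      · intro i hi
        have h := hz' i (by omega)
        exact ⟨⟨(hz i (by omega)).1.1.trans h.1.1.le,
          h.1.2.le.trans (hz (i+1) (by omega)).1.2⟩, h.2⟩
      · intro i hi
        exact (hz' i (by omega)).1.2.trans (hz' (i+1) (by omega)).1.1

theorem aux_zero (w w' : ℝ → ℝ) (M p q r s : ℝ) (hpq : p < q) (hqr : q ≤ r) (hrs : r < s)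
    (hd : ∀ x ∈ Icc p s, HasDerivAt w (w' x) x)
    (h1 : ∀ t ∈ Ioo p q, |w t| < M) (h2 : ∀ t ∈ Ioo r s, |w t| < M)
    (hp : |w p| = M) (hq : |w q| = M) (hr : |w r| = M) :
    ∃ x ∈ Ioc p r, w' x = 0 := by
  have rolle : ∀ c d, p ≤ c → c < d → d ≤ r → w c = w d → ∃ x ∈ Ioc p r, w' x = 0 := by
    intro c d hc hcd hdr h
    obtain ⟨x, hx, hx0⟩ := exists_hasDerivAt_eq_zero (f := w) (f' := w') hcd
      (fun y hy => (hd y ⟨hc.trans hy.1, (hy.2.trans hdr).trans hrs.le⟩).continuousAt.continuousWithinAt)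
      h (fun y hy => hd y ⟨hc.trans hy.1.le, (hy.2.le.trans hdr).trans hrs.le⟩)
    exact ⟨x, ⟨hc.trans_lt hx.1, hx.2.le.trans hdr⟩, hx0⟩
  by_cases e1 : w p = w q
  · exact rolle p q le_rfl hpq hqr e1
  by_cases e2 : w p = w r
  · exact rolle p r le_rfl (hpq.trans_le hqr) le_rfl e2
  have e3 : w q = w r := by
    have hpq' : |w p| = |w q| := hp.trans hq.symm
    have hpr' : |w p| = |w r| := hp.trans hr.symm
    rcases abs_eq_abs.1 hpq' with h | h
    · exact absurd h e1
    rcases abs_eq_abs.1 hpr' with h' | h'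
    · exact absurd h' e2
    linarith
  rcases hqr.lt_or_eq with h | h
  · exact rolle q r hpq.le h le_rfl e3
  subst h
  refine ⟨q, ⟨hpq, le_rfl⟩, ?_⟩
  have hnear : ∀ᶠ t in nhds q, |w t| ≤ M := by
    filter_upwards [Ioo_mem_nhds hpq hrs] with t ht
    rcases lt_trichotomy t q with h | h | h
    · exact (h1 t ⟨ht.1, h⟩).le
    · rw [h, hq]
    · exact (h2 t ⟨h, ht.2⟩).le
  have hdq := hd q ⟨hpq.le, hrs.le⟩
  rcases abs_choice (w q) with h | h
  · have : IsLocalMax w q := by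
      filter_upwards [hnear] with t ht
      have := le_abs_self (w t)
      linarith
    exact this.hasDerivAt_eq_zero hdq
  · have : IsLocalMin w q := by
      filter_upwards [hnear] with t ht
      have := neg_abs_le (w t)
      linarith
    exact this.hasDerivAt_eq_zero hdq

theorem aux_top (g f : ℝ → ℝ) (a b z t A L c : ℝ) (hab : a ≤ b) (hc : 0 < c)
    (hd : ∀ x ∈ Icc a b, HasDerivAt g (f x) x) (hf : ContinuousOn f (Icc a b))
    (hz : z ∈ Icc a b) (ht : t ∈ Icc a b) (hgz : g z = 0)
    (hA : ∫ x in Ioo a b, f x ^ 2 ≤ A) (hL : b - a ≤ L) :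
    |g t| ≤ (c * A + L / c) / 2 := by
  have hsub : uIcc z t ⊆ Icc a b := uIcc_subset_Icc hz ht
  have hftc : ∫ x in z..t, f x = g t - g z :=
    intervalIntegral.integral_eq_sub_of_hasDerivAt (fun x hx => hd x (hsub hx))
      ((hf.mono hsub).intervalIntegrable)
  have hint2 : IntegrableOn (fun x => (c * f x ^ 2 + 1 / c) / 2) (Icc a b) :=
    ContinuousOn.integrableOn_Icc (by fun_prop)
  have hint : IntegrableOn f (Icc a b) := hf.integrableOn_Icc
  have hsq : IntegrableOn (fun x => f x ^ 2) (Icc a b) :=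
    ContinuousOn.integrableOn_Icc (by fun_prop)
  have h1 : |g t| ≤ ∫ x in Icc a b, |f x| := by
    have : g t = ∫ x in z..t, f x := by rw [hftc, hgz, sub_zero]
    rw [this]
    have h := intervalIntegral.norm_integral_le_integral_norm_uIoc (f := f) (a := z) (b := t)
      (μ := volume)
    refine h.trans ?_
    exact setIntegral_mono_set hint.norm (Filter.Eventually.of_forall fun x => norm_nonneg _)
      (Filter.Eventually.of_forall (uIoc_subset_uIcc.trans hsub))
  have h2 : ∫ x in Icc a b, |f x| ≤ ∫ x in Icc a b, (c * f x ^ 2 + 1 / c) / 2 := by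
    refine integral_mono hint.abs hint2 fun x => ?_
    have h := sq_nonneg (c * |f x| - 1)
    rw [← sq_abs (f x)]
    simp only
    have e : (c * |f x| ^ 2 + 1 / c) / 2 - |f x| = (c * |f x| - 1) ^ 2 / (2 * c) := by
      field_simp
      ring
    have : 0 ≤ (c * |f x| - 1) ^ 2 / (2 * c) := by positivity
    linarith
  have h3 : ∫ x in Icc a b, (c * f x ^ 2 + 1 / c) / 2
      = (c * (∫ x in Ioo a b, f x ^ 2) + (b - a) / c) / 2 := by
    rw [integral_div, integral_add (hsq.const_mul c) (by simp), integral_const_mul,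
      integral_Icc_eq_integral_Ioo]
    simp [hab]
    ring
  rw [h3] at h2
  refine (h1.trans h2).trans ?_
  gcongr

theorem counting_lemma (k : ℕ) (hk : 3 ≤ k) (S : ℝ) (hS : 0 < S)
    (N : ℝ) (hN : 1 ≤ N) (hNS : 1 ≤ 2 * N ^ 2 * S)
    (ε : ℝ) (hε : ε ∈ Ioo (0:ℝ) 1)
    (a b : ℝ) (hab : a < b) (hlen : b - a ≤ ε / (2 * N ^ 2 * S))
    (u : ℝ → ℝ) (hu : ∃ U : Set ℝ, IsOpen U ∧ Icc a b ⊆ U ∧ ContDiffOn ℝ k u U)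
    (hF : Fe k ε u a b ≤ S) :
    ¬ ∃ aa bb : Fin (k - 1) → ℝ,
      (∀ i, aa i < bb i) ∧
      (∀ i j, i < j → bb i ≤ aa j) ∧
      (∀ i, a ≤ aa i ∧ bb i ≤ b) ∧
      (∀ i, ∀ t ∈ Ioo (aa i) (bb i), |deriv u t| < 1 / Real.sqrt ε) ∧
      (∀ i, |deriv u (aa i)| = 1 / Real.sqrt ε ∧ |deriv u (bb i)| = 1 / Real.sqrt ε) ∧
      (∀ i, volume {t ∈ Ioo (aa i) (bb i) |
        ∀ ℓ : ℕ, 2 ≤ ℓ → ℓ ≤ k - 1 → |iteratedDeriv ℓ u t| < 1 / (N * ε ^ ℓ)} = 0) := by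
  rintro ⟨aa, bb, hlt, hord, hin, hsm, hend, hvol⟩
  obtain ⟨U, hU, hsubU, hcd⟩ := hu
  have hε0 : 0 < ε := hε.1
  have hN0 : 0 < N := by linarith
  have hD : ∀ j < k, ∀ x ∈ Icc a b,
      HasDerivAt (iteratedDeriv j u) (iteratedDeriv (j+1) u x) x := by
    intro j hj x hx
    rw [iteratedDeriv_succ]
    refine DifferentiableAt.hasDerivAt ?_
    have h := (hcd.differentiableOn_iteratedDerivWithin (m := j) (by exact_mod_cast hj)
      hU.uniqueDiffOn).differentiableAt (hU.mem_nhds (hsubU hx))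
    refine h.congr_of_eventuallyEq ?_
    filter_upwards [hU.mem_nhds (hsubU hx)] with y hy
    exact (iteratedDerivWithin_of_isOpen hU hy).symm
  have hDk : ContinuousOn (iteratedDeriv k u) (Icc a b) := by
    have h : ContinuousOn (iteratedDerivWithin k u U) U :=
      hcd.continuousOn_iteratedDerivWithin le_rfl hU.uniqueDiffOn
    exact (h.congr fun x hx => (iteratedDerivWithin_of_isOpen hU hx).symm).mono hsubU
  -- zeros of u''
  have key : ∀ i, ∃ x, ∀ h : i + 1 < k - 1,
      x ∈ Ioc (aa ⟨i, by omega⟩) (aa ⟨i+1, h⟩) ∧ iteratedDeriv 2 u x = 0 := by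
    intro i
    by_cases h : i + 1 < k - 1
    · obtain ⟨x, hx, hx0⟩ := aux_zero (deriv u) (iteratedDeriv 2 u) (1 / Real.sqrt ε)
        (aa ⟨i, by omega⟩) (bb ⟨i, by omega⟩) (aa ⟨i+1, h⟩) (bb ⟨i+1, h⟩)
        (hlt _) (hord _ _ (by simp [Fin.lt_def])) (hlt _)
        (fun x hx => by
          have := hD 1 (by omega) x ⟨(hin _).1.trans hx.1, hx.2.trans (hin _).2⟩
          rwa [iteratedDeriv_one] at this)
        (hsm _) (hsm _) (hend _).1 (hend _).2 (hend _).1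
      exact ⟨x, fun _ => ⟨hx, hx0⟩⟩
    · exact ⟨0, fun h' => absurd h' h⟩
  choose z hz using key
  have zeros := aux_rolle a b (k - 3) (fun j => iteratedDeriv (j + 2) u) z
    (fun j hj x hx => hD (j+2) (by omega) x hx)
    (fun i hi => by
      have h := hz i (by omega)
      exact ⟨⟨(hin _).1.trans h.1.1.le, h.1.2.trans ((hlt _).le.trans (hin _).2)⟩, h.2⟩)
    (fun i hi => (hz i (by omega)).1.2.trans_lt (hz (i+1) (by omega)).1.1)
  have zeros' : ∀ ℓ, 2 ≤ ℓ → ℓ ≤ k - 1 → ∃ x ∈ Icc a b, iteratedDeriv ℓ u x = 0 := by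
    intro ℓ h2 hl
    obtain ⟨x, hx, h⟩ := zeros (ℓ - 2) (by omega)
    refine ⟨x, hx, ?_⟩
    simpa [Nat.sub_add_cancel h2] using h
  have hI : ∫ t in Ioo a b, (iteratedDeriv k u t) ^ 2 ≤ S / ε ^ (2 * k - 1) := by
    rw [le_div_iff₀ (by positivity)]
    have h0 : 0 ≤ ∫ t in Ioo a b, min ((deriv u t) ^ 2) (1 / ε) :=
      integral_nonneg fun t => le_min (sq_nonneg _) (by positivity)
    unfold Fe at hF
    linarith
  have hlen' : b - a ≤ ε := hlen.trans (div_le_self hε0.le hNS)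
  -- all derivatives small
  have small : ∀ m, ∀ ℓ, 2 ≤ ℓ → ℓ + m = k - 1 → ∀ t ∈ Icc a b,
      |iteratedDeriv ℓ u t| < 1 / (N * ε ^ ℓ) := by
    intro m
    induction m with
    | zero =>
      intro ℓ h2 hl t ht
      obtain ⟨x, hx, hx0⟩ := zeros' ℓ h2 (by omega)
      obtain rfl : k = ℓ + 1 := by omega
      have h := aux_top (iteratedDeriv ℓ u) (iteratedDeriv (ℓ+1) u) a b x t _ _
        (ε ^ (ℓ+1) / (N * S)) hab.le (by positivity) (fun x hx => hD ℓ (by omega) x hx)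
        hDk hx ht hx0 hI hlen
      refine h.trans_lt ?_
      have e : 2 * (ℓ + 1) - 1 = ℓ + ℓ + 1 := by omega
      have : (ε ^ (ℓ+1) / (N * S) * (S / ε ^ (2 * (ℓ + 1) - 1)) +
          ε / (2 * N ^ 2 * S) / (ε ^ (ℓ+1) / (N * S))) / 2 = (3 / 4) * (1 / (N * ε ^ ℓ)) := by
        rw [e]
        field_simp
        ring
      rw [this]
      have : 0 < 1 / (N * ε ^ ℓ) := by positivity
      linarith
    | succ m ih =>
      intro ℓ h2 hl t ht
      obtain ⟨x, hx, hx0⟩ := zeros' ℓ h2 (by omega)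
      have ih' := ih (ℓ+1) (by omega) (by omega)
      have hpos : 0 < 1 / (N * ε ^ ℓ) := by positivity
      have mv : ∀ c d, c ∈ Icc a b → d ∈ Icc a b → c < d →
          |iteratedDeriv ℓ u d - iteratedDeriv ℓ u c| < 1 / (N * ε ^ ℓ) := by
        intro c d hc hd hcd
        have hs : Icc c d ⊆ Icc a b := Icc_subset_Icc hc.1 hd.2
        obtain ⟨y, hy, hy'⟩ := exists_hasDerivAt_eq_slope (iteratedDeriv ℓ u)
          (iteratedDeriv (ℓ+1) u) hcd
          (fun y hy => (hD ℓ (by omega) y (hs hy)).continuousAt.continuousWithinAt)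
          (fun y hy => hD ℓ (by omega) y (hs (Ioo_subset_Icc_self hy)))
        rw [eq_div_iff (by linarith)] at hy'
        rw [← hy', abs_mul, abs_of_pos (sub_pos.2 hcd)]
        have h1 := ih' y (hs (Ioo_subset_Icc_self hy))
        have h3 : d - c ≤ ε := by linarith [hc.1, hd.2]
        calc |iteratedDeriv (ℓ+1) u y| * (d - c) ≤ |iteratedDeriv (ℓ+1) u y| * ε := by gcongr
          _ < 1 / (N * ε ^ (ℓ+1)) * ε := by gcongr
          _ = 1 / (N * ε ^ ℓ) := by
            field_simp
            ring
      rcases lt_trichotomy x t with h | h | h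
      · simpa [hx0] using mv x t hx ht h
      · rw [← h, hx0, abs_zero]; exact hpos
      · simpa [hx0] using mv t x ht hx h
  have i0 : Fin (k - 1) := ⟨0, by omega⟩
  have hv := hvol i0
  have : {t ∈ Ioo (aa i0) (bb i0) |
        ∀ ℓ : ℕ, 2 ≤ ℓ → ℓ ≤ k - 1 → |iteratedDeriv ℓ u t| < 1 / (N * ε ^ ℓ)}
        = Ioo (aa i0) (bb i0) := by
    ext t
    refine ⟨fun h => h.1, fun h => ⟨h, fun ℓ h2 hl => ?_⟩⟩
    exact small (k - 1 - ℓ) ℓ h2 (by omega) t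
      ⟨(hin _).1.trans h.1.le, h.2.le.trans (hin _).2⟩
  rw [this, Real.volume_Ioo, ENNReal.ofReal_eq_zero] at hv
  linarith [hlt i0]
end

section
/- Let k ≥ 3 be an integer, S > 0 and N ≥ 1 with 2N²S ≥ 1. There exists a constant C > 0, depending only on k, S and N, such that for every ε ∈ (0,1), every bounded open interval I, and every function u that is k times continuously differentiable on a neighbourhood of the closure of I with F_ε(u; I) ≤ S, if the set { t ∈ I : |u'(t)| < 1/√ε and |u^{(ℓ)}(t)| < 1/(N ε^ℓ) for all ℓ ∈ {2,…,k−1} } has Lebesgue measure zero, then the Lebesgue measure of { t ∈ I : |u'(t)| < 1/√ε } is at most C ε^{1/(2(k−2))} (2N²S|I| + ε). -/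
open MeasureTheory Set

theorem sublevel_aux (g : ℕ → ℝ → ℝ) (δ ρ : ℝ) (hδ : 0 < δ) (hρ : 0 < ρ) :
    ∀ (j : ℕ), ∃ K : ℝ, K = 2 ^ (j+1) - 2 ∧ ∀ Q : Set ℝ, Q.OrdConnected →
      (∀ i < j, ∀ t ∈ Q, HasDerivAt (g i) (g (i+1) t) t) →
      (∀ t ∈ Q, δ / ρ ^ j ≤ |g j t|) →
      volume {t ∈ Q | |g 0 t| < δ} ≤ ENNReal.ofReal (K * ρ) := by
  intro j
  induction j with
  | zero =>
    refine ⟨_, rfl, fun Q hQ _ h => ?_⟩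
    have : {t ∈ Q | |g 0 t| < δ} = ∅ := by
      ext t
      simp only [mem_ofPred_eq, mem_empty_iff_false, iff_false, not_and, not_lt]
      intro ht
      simpa using h t ht
    rw [this]; simp
  | succ j ih =>
    obtain ⟨K, hK, ih⟩ := ih
    have hK0 : 0 ≤ K := by
      rw [hK, pow_succ]; have := one_le_pow₀ (M₀ := ℝ) (a := 2) (by norm_num) (n := j); linarith
    refine ⟨_, rfl, fun Q hQ hd h => ?_⟩
    have hlam : 0 < δ / ρ ^ (j+1) := by positivity
    have hne : ∀ t ∈ Q, g (j+1) t ≠ 0 := by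
      intro t ht h0
      have := h t ht
      rw [h0, abs_zero] at this; linarith
    have hdj := hd j (Nat.lt_succ_self j)
    have hcont : ContinuousOn (g j) Q := fun t ht => (hdj t ht).continuousAt.continuousWithinAt
    have hmono : MonotoneOn (g j) Q ∨ AntitoneOn (g j) Q := by
      rcases hasDerivWithinAt_forall_lt_or_forall_gt_of_forall_ne (f := g j) (f' := g (j+1)) hQ.convex
        (fun t ht => (hdj t ht).hasDerivWithinAt) hne with h1 | h1
      · right
        refine antitoneOn_of_deriv_nonpos hQ.convex hcont
          (fun t ht => (hdj t (interior_subset ht)).differentiableAt.differentiableWithinAt) ?_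
        intro t ht
        rw [(hdj t (interior_subset ht)).deriv]
        exact (h1 t (interior_subset ht)).le
      · left
        refine monotoneOn_of_deriv_nonneg hQ.convex hcont
          (fun t ht => (hdj t (interior_subset ht)).differentiableAt.differentiableWithinAt) ?_
        intro t ht
        rw [(hdj t (interior_subset ht)).deriv]
        exact (h1 t (interior_subset ht)).le
    set α := δ / ρ ^ j with hα
    have hαl : α = ρ * (δ / ρ ^ (j+1)) := by rw [hα]; field_simp; ring
    have hlt : ∀ x ∈ Q, ∀ y ∈ Q, x < y → |g j x| < α → |g j y| < α → y - x ≤ 2 * ρ := by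
      intro x hx y hy hxy h1 h2
      have hsub := hQ.out hx hy
      obtain ⟨c, hc, hcs⟩ := exists_hasDerivAt_eq_slope (g j) (g (j+1)) hxy (hcont.mono hsub)
        (fun t ht => hdj t (hsub (Ioo_subset_Icc_self ht)))
      have h3 := h c (hsub (Ioo_subset_Icc_self hc))
      rw [hcs, abs_div, abs_of_pos (sub_pos.2 hxy), le_div_iff₀ (sub_pos.2 hxy)] at h3
      have h4 : |g j y - g j x| ≤ |g j y| + |g j x| := abs_sub _ _
      by_contra hcon
      push Not at hcon
      have := mul_lt_mul_of_pos_left hcon hlam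
      nlinarith
    have hmid : volume {t ∈ Q | |g j t| < α} ≤ ENNReal.ofReal (2 * ρ) := by
      refine (Real.volume_le_diam _).trans ?_
      refine Metric.ediam_le ?_
      rintro x ⟨hx, hx2⟩ y ⟨hy, hy2⟩
      rw [edist_dist, Real.dist_eq]
      apply ENNReal.ofReal_le_ofReal
      rcases lt_trichotomy x y with h1 | h1 | h1
      · rw [abs_sub_comm, abs_of_pos (sub_pos.2 h1)]; exact hlt x hx y hy h1 hx2 hy2
      · rw [h1]; simp; positivity
      · rw [abs_of_pos (sub_pos.2 h1)]; exact hlt y hy x hx h1 hy2 hx2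
    have hP : ({t ∈ Q | α ≤ g j t}).OrdConnected := by
      refine ⟨fun x hx y hy z hz => ?_⟩
      have hzQ := hQ.out hx.1 hy.1 hz
      refine ⟨hzQ, ?_⟩
      rcases hmono with hm | hm
      · exact hx.2.trans (hm hx.1 hzQ hz.1)
      · exact hy.2.trans (hm hzQ hy.1 hz.2)
    have hM : ({t ∈ Q | g j t ≤ -α}).OrdConnected := by
      refine ⟨fun x hx y hy z hz => ?_⟩
      have hzQ := hQ.out hx.1 hy.1 hz
      refine ⟨hzQ, ?_⟩
      rcases hmono with hm | hm
      · exact (hm hzQ hy.1 hz.2).trans hy.2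
      · exact (hm hx.1 hzQ hz.1).trans hx.2
    have e1 := ih _ hP (fun i hi t ht => hd i (by omega) t ht.1)
      (fun t ht => ht.2.trans (le_abs_self _))
    have e2 := ih _ hM (fun i hi t ht => hd i (by omega) t ht.1)
      (fun t ht => (le_neg_of_le_neg ht.2).trans (neg_le_abs _))
    have hsub : {t ∈ Q | |g 0 t| < δ} ⊆ {t ∈ Q | |g j t| < α} ∪
        ({t ∈ {t ∈ Q | α ≤ g j t} | |g 0 t| < δ} ∪ {t ∈ {t ∈ Q | g j t ≤ -α} | |g 0 t| < δ}) := by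
      rintro t ⟨ht, ht2⟩
      by_cases h1 : |g j t| < α
      · exact Or.inl ⟨ht, h1⟩
      · right
        rcases le_abs.1 (not_lt.1 h1) with h2 | h2
        · exact Or.inl ⟨⟨ht, h2⟩, ht2⟩
        · exact Or.inr ⟨⟨ht, by linarith⟩, ht2⟩
    calc _ ≤ _ := measure_mono hsub
      _ ≤ _ := measure_union_le _ _
      _ ≤ ENNReal.ofReal (2 * ρ) + (ENNReal.ofReal (K * ρ) + ENNReal.ofReal (K * ρ)) :=
        add_le_add hmid ((measure_union_le _ _).trans (add_le_add e1 e2))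
      _ = ENNReal.ofReal ((2 ^ (j+1+1) - 2) * ρ) := by
        rw [← ENNReal.ofReal_add (by positivity) (by positivity),
          ← ENNReal.ofReal_add (by positivity) (by positivity), hK]
        congr 1; ring

theorem cover_aux (E : Set ℝ) (a b : ℝ) (hab : a < b) (n : ℕ) (hn : 0 < n) (M : ℝ)
    (hE : E ⊆ Ioo a b)
    (h : ∀ x y, a ≤ x → y ≤ b → x ≤ y → y - x ≤ (b - a) / n →
      volume (E ∩ Icc x y) ≤ ENNReal.ofReal M) :
    volume E ≤ ENNReal.ofReal (n * M) := by
  have hn' : (0:ℝ) < n := by exact_mod_cast hn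
  set d := (b - a) / n with hd
  have hd0 : 0 < d := div_pos (sub_pos.2 hab) hn'
  have hnd : n * d = b - a := by rw [hd]; field_simp
  have hsub : E ⊆ ⋃ i ∈ Finset.range n, E ∩ Icc (a + i * d) (a + (i+1) * d) := by
    intro t ht
    have hab' := hE ht
    have h0 : 0 ≤ (t - a) / d := div_nonneg (by linarith [hab'.1]) hd0.le
    simp only [mem_iUnion, Finset.mem_range]
    have h1 := Nat.floor_le h0
    have h2 := Nat.lt_floor_add_one ((t - a) / d)
    rw [le_div_iff₀ hd0] at h1
    rw [div_lt_iff₀ hd0] at h2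
    refine ⟨⌊(t - a) / d⌋₊, ?_, ht, by linarith, by linarith⟩
    rw [Nat.floor_lt h0, div_lt_iff₀ hd0, hnd]
    linarith [hab'.2]
  calc _ ≤ _ := measure_mono hsub
    _ ≤ ∑ i ∈ Finset.range n, volume (E ∩ Icc (a + i * d) (a + (i+1) * d)) :=
      measure_biUnion_finset_le _ _
    _ ≤ ∑ i ∈ Finset.range n, ENNReal.ofReal M := by
      refine Finset.sum_le_sum fun i hi => ?_
      have hi' : ((i:ℝ) + 1) ≤ n := by exact_mod_cast Finset.mem_range.1 hi
      apply h
      · have : (0:ℝ) ≤ i * d := by positivity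
        linarith
      · have := mul_le_mul_of_nonneg_right hi' hd0.le
        linarith
      · linarith
      · linarith
    _ = _ := by
      rw [Finset.sum_const, Finset.card_range, ENNReal.ofReal_mul hn'.le, nsmul_eq_mul]
      simp

theorem deriv_aux (k : ℕ) (u : ℝ → ℝ) (U : Set ℝ) (hU : IsOpen U) (h : ContDiffOn ℝ k u U)
    (t : ℝ) (ht : t ∈ U) (l : ℕ) (hl : l < k) :
    HasDerivAt (iteratedDeriv l u) (iteratedDeriv (l+1) u t) t := by
  rw [iteratedDeriv_succ]
  apply DifferentiableAt.hasDerivAt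
  have h1 := h.differentiableOn_iteratedDerivWithin (m := l) (by exact_mod_cast hl) hU.uniqueDiffOn
  have h2 := (iteratedDerivWithin_of_isOpen (f := u) (n := l) hU)
  exact (h1.congr fun x hx => (h2 hx).symm).differentiableAt (hU.mem_nhds ht)

theorem cont_aux (k : ℕ) (u : ℝ → ℝ) (U : Set ℝ) (hU : IsOpen U) (h : ContDiffOn ℝ k u U) :
    ContinuousOn (iteratedDeriv k u) U := by
  have h1 := h.continuousOn_iteratedDerivWithin (m := k) le_rfl hU.uniqueDiffOn
  have h2 := (iteratedDerivWithin_of_isOpen (f := u) (n := k) hU)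
  exact h1.congr fun x hx => (h2 hx).symm

/-- Oscillation bound from the L2 bound. -/
theorem osc_aux (f g : ℝ → ℝ) (a b x y p V : ℝ) (hp : 0 < p) (hax : a ≤ x) (hxy : x ≤ y) (hyb : y ≤ b)
    (hd : ∀ t ∈ Icc a b, HasDerivAt f (g t) t) (hg : ContinuousOn g (Icc a b))
    (hV : ∫ t in Ioo a b, (g t) ^ 2 ≤ V) :
    |f y - f x| ≤ (p * V + (y - x) / p) / 2 := by
  have hsub : Icc x y ⊆ Icc a b := Icc_subset_Icc hax hyb
  have hgi : IntervalIntegrable g volume x y := by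
    apply ContinuousOn.intervalIntegrable
    rw [uIcc_of_le hxy]; exact hg.mono hsub
  have hgi2 : IntervalIntegrable (fun t => (g t)^2) volume x y := by
    apply ContinuousOn.intervalIntegrable
    rw [uIcc_of_le hxy]; exact (hg.mono hsub).pow 2
  have e1 : ∫ t in x..y, g t = f y - f x := by
    apply intervalIntegral.integral_eq_sub_of_hasDerivAt _ hgi
    rw [uIcc_of_le hxy]
    exact fun t ht => hd t (hsub ht)
  have e2 : ∫ t in x..y, (g t)^2 ≤ V := by
    refine le_trans ?_ hV
    rw [intervalIntegral.integral_of_le hxy, ← integral_Ioc_eq_integral_Ioo]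
    apply setIntegral_mono_set
    · exact ((hg.pow 2).integrableOn_Icc).mono_set Ioc_subset_Icc_self
    · exact Filter.Eventually.of_forall fun t => sq_nonneg _
    · exact (Ioc_subset_Ioc hax hyb).eventuallyLE
  have e3 : |∫ t in x..y, g t| ≤ ∫ t in x..y, (p * (g t)^2 + 1 / p) / 2 := by
    refine (intervalIntegral.abs_integral_le_integral_abs hxy).trans ?_
    apply intervalIntegral.integral_mono_on hxy hgi.abs
    · exact ((hgi2.const_mul p).add intervalIntegrable_const).div_const 2
    · intro t _
      have h1 : 0 ≤ (p * |g t| - 1) ^ 2 / p := by positivity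
      have h2 : (p * |g t| - 1) ^ 2 / p = p * (g t)^2 + 1 / p - 2 * |g t| := by
        rw [← sq_abs (g t)]; field_simp; ring
      linarith
  have e4 : ∫ t in x..y, (p * (g t)^2 + 1 / p) / 2 = (p * (∫ t in x..y, (g t)^2) + (y - x) / p) / 2 := by
    rw [intervalIntegral.integral_div, intervalIntegral.integral_add (hgi2.const_mul p)
      intervalIntegrable_const, intervalIntegral.integral_const_mul, intervalIntegral.integral_const]
    simp [div_eq_mul_inv]
  rw [← e1]
  refine e3.trans ?_
  rw [e4]
  have := mul_le_mul_of_nonneg_left e2 hp.le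
  linarith

theorem dich_aux (k : ℕ) (S : ℝ) (hS : 0 < S) (N : ℝ) (hN : 1 ≤ N)
    (hNS : 1 ≤ 2 * N ^ 2 * S) (ε : ℝ) (hε : 0 < ε) (a b : ℝ)
    (u : ℝ → ℝ) (hk : 3 ≤ k)
    (hd : ∀ l < k, ∀ t ∈ Icc a b, HasDerivAt (iteratedDeriv l u) (iteratedDeriv (l+1) u t) t)
    (hc : ContinuousOn (iteratedDeriv k u) (Icc a b))
    (hV : ∫ t in Ioo a b, (iteratedDeriv k u t) ^ 2 ≤ S / ε ^ (2 * k - 1))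
    (x y : ℝ) (hax : a ≤ x) (hyb : y ≤ b) (hyx : y - x ≤ ε * (1 / (4 * N ^ 2 * S)))
    (hno : ∀ l, 2 ≤ l → l ≤ k - 1 → ∃ t ∈ Icc x y, |iteratedDeriv l u t| < 1 / (2 * N * ε ^ l)) :
    ∀ i, i ≤ k - 3 → ∀ t ∈ Icc x y, |iteratedDeriv (k - 1 - i) u t| < 1 / (N * ε ^ (k - 1 - i)) := by
  have hN0 : 0 < N := by linarith
  have hh : 1 / (4 * N ^ 2 * S) ≤ 1 / 2 := by
    apply one_div_le_one_div_of_le <;> linarith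
  have hsub : Icc x y ⊆ Icc a b := Icc_subset_Icc hax hyb
  have key : ∀ l, 2 ≤ l → l ≤ k - 1 →
      (∀ s ∈ Icc x y, ∀ t ∈ Icc x y, s ≤ t →
        |iteratedDeriv l u t - iteratedDeriv l u s| ≤ 1 / (2 * N * ε ^ l)) →
      ∀ t ∈ Icc x y, |iteratedDeriv l u t| < 1 / (N * ε ^ l) := by
    intro l h2 hl hosc t ht
    obtain ⟨s, hs, hs2⟩ := hno l h2 hl
    have h1 : |iteratedDeriv l u t - iteratedDeriv l u s| ≤ 1 / (2 * N * ε ^ l) := by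
      rcases le_total s t with h | h
      · exact hosc s hs t ht h
      · rw [abs_sub_comm]; exact hosc t ht s hs h
    have h3 := abs_sub_abs_le_abs_sub (iteratedDeriv l u t) (iteratedDeriv l u s)
    have h4 : 1 / (N * ε ^ l) = 1 / (2 * N * ε ^ l) + 1 / (2 * N * ε ^ l) := by field_simp; ring
    linarith
  intro i
  induction i with
  | zero =>
    intro _
    apply key _ (by omega) (by omega)
    intro s hs t ht hst
    obtain ⟨m, rfl⟩ : ∃ m, k = m + 1 := ⟨k - 1, by omega⟩
    have e : 2 * (m + 1) - 1 = 2 * m + 1 := by omega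
    rw [e] at hV
    simp only [Nat.add_sub_cancel, Nat.sub_zero]
    have hd' := hd m (by omega)
    have hp : 0 < ε ^ (m+1) / (2 * N * S) := by positivity
    have h1 := osc_aux (iteratedDeriv m u) (iteratedDeriv (m+1) u) a b s t _ _ hp
      (hax.trans hs.1) hst (ht.2.trans hyb) hd' hc hV
    refine h1.trans ?_
    have h2 : t - s ≤ ε * (1 / (4 * N ^ 2 * S)) := by linarith [hs.1, ht.2]
    have h3 := div_le_div_of_nonneg_right h2 hp.le
    have h4 : ε * (1 / (4 * N ^ 2 * S)) / (ε ^ (m+1) / (2 * N * S)) = 1 / (2 * N * ε ^ m) := by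
      rw [pow_succ]; field_simp; ring
    have h5 : ε ^ (m+1) / (2 * N * S) * (S / ε ^ (2 * m + 1)) = 1 / (2 * N * ε ^ m) := by
      rw [show 2 * m + 1 = (m + 1) + m by ring, pow_add ε (m+1) m]; field_simp
    linarith
  | succ i ih =>
    intro hi
    apply key _ (by omega) (by omega)
    have ih := ih (by omega)
    obtain ⟨l, hl⟩ : ∃ l, l = k - 1 - (i + 1) := ⟨_, rfl⟩
    have hl' : k - 1 - i = l + 1 := by omega
    rw [← hl]
    rw [hl'] at ih
    intro s hs t ht hst
    have h1 := (convex_Icc x y).norm_image_sub_le_of_norm_hasDerivWithin_le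
      (f := iteratedDeriv l u) (f' := iteratedDeriv (l+1) u) (C := 1 / (N * ε ^ (l+1)))
      (fun z hz => (hd l (by omega) z (hsub hz)).hasDerivWithinAt)
      (fun z hz => (ih z hz).le) hs ht
    rw [Real.norm_eq_abs, Real.norm_eq_abs, abs_of_nonneg (sub_nonneg.2 hst)] at h1
    refine h1.trans ?_
    have h2 : t - s ≤ ε * (1 / 2) := by
      have := mul_le_mul_of_nonneg_left hh hε.le
      linarith [hs.1, ht.2]
    calc _ ≤ 1 / (N * ε ^ (l+1)) * (ε * (1/2)) := by gcongr
      _ = _ := by rw [pow_succ]; field_simp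

theorem measure_below_threshold_bound (k : ℕ) (hk : 3 ≤ k) (S : ℝ) (hS : 0 < S)
    (N : ℝ) (hN : 1 ≤ N) (hNS : 1 ≤ 2 * N ^ 2 * S) :
    ∃ C : ℝ, 0 < C ∧
      ∀ ε ∈ Ioo (0:ℝ) 1, ∀ a b : ℝ, a < b →
      ∀ u : ℝ → ℝ, (∃ U : Set ℝ, IsOpen U ∧ Icc a b ⊆ U ∧ ContDiffOn ℝ k u U) →
      Fe k ε u a b ≤ S →
      volume {t ∈ Ioo a b | |deriv u t| < 1 / Real.sqrt ε ∧
        ∀ ℓ : ℕ, 2 ≤ ℓ → ℓ ≤ k - 1 → |iteratedDeriv ℓ u t| < 1 / (N * ε ^ ℓ)} = 0 →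
      volume {t ∈ Ioo a b | |deriv u t| < 1 / Real.sqrt ε} ≤
        ENNReal.ofReal (C * ε ^ ((1:ℝ) / (2 * ((k:ℝ) - 2))) * (2 * N ^ 2 * S * (b - a) + ε)) := by
  have hN0 : 0 < N := by linarith
  refine ⟨2 ^ (k + 2) * N, by positivity, ?_⟩
  rintro ε ⟨hε, hε1⟩ a b hab u ⟨U, hU, hIU, hu⟩ hF hZ
  have hd : ∀ l < k, ∀ t ∈ Icc a b, HasDerivAt (iteratedDeriv l u) (iteratedDeriv (l+1) u t) t :=
    fun l hl t ht => deriv_aux k u U hU hu t (hIU ht) l hl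
  have hc : ContinuousOn (iteratedDeriv k u) (Icc a b) := (cont_aux k u U hU hu).mono hIU
  have hV : ∫ t in Ioo a b, (iteratedDeriv k u t) ^ 2 ≤ S / ε ^ (2 * k - 1) := by
    rw [le_div_iff₀ (by positivity), mul_comm]
    have : 0 ≤ ∫ t in Ioo a b, min ((deriv u t) ^ 2) (1 / ε) :=
      integral_nonneg fun t => le_min (sq_nonneg _) (by positivity)
    unfold Fe at hF
    linarith
  set w : ℝ := ε ^ ((1:ℝ) / (2 * ((k:ℝ) - 2))) with hw
  have hk2 : (0:ℝ) < (k:ℝ) - 2 := by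
    have : (3:ℝ) ≤ k := by exact_mod_cast hk
    linarith
  have hw0 : 0 < w := Real.rpow_pos_of_pos hε _
  have hw1 : w ≤ 1 := Real.rpow_le_one hε.le hε1.le (by positivity)
  have hwk : w ^ (k - 2) = Real.sqrt ε := by
    rw [hw, ← Real.rpow_natCast, ← Real.rpow_mul hε.le, Real.sqrt_eq_rpow]
    congr 1
    rw [Nat.cast_sub (by omega)]
    push_cast
    field_simp
  have hsq : 0 < Real.sqrt ε := Real.sqrt_pos.2 hε
  set d0 : ℝ := ε * (1 / (4 * N ^ 2 * S)) with hd0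
  have hd0p : 0 < d0 := by positivity
  set M : ℝ := 2 ^ k * (ε * (2 * N * w)) with hM
  set E := {t ∈ Ioo a b | |deriv u t| < 1 / Real.sqrt ε} with hE
  have hloc : ∀ x y, a ≤ x → y ≤ b → x ≤ y → y - x ≤ d0 →
      volume (E ∩ Icc x y) ≤ ENNReal.ofReal M := by
    intro x y hax hyb hxy hyx
    have hsub : Icc x y ⊆ Icc a b := Icc_subset_Icc hax hyb
    by_cases hno : ∀ l, 2 ≤ l → l ≤ k - 1 → ∃ t ∈ Icc x y, |iteratedDeriv l u t| < 1 / (2 * N * ε ^ l)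
    · have h1 := dich_aux k S hS N hN hNS ε hε a b u hk hd hc hV x y hax hyb hyx hno
      have h0 : volume (E ∩ Icc x y) = 0 := by
        refine measure_mono_null ?_ hZ
        rintro t ⟨⟨ht, ht2⟩, htQ⟩
        refine ⟨ht, ht2, fun l hl2 hlk => ?_⟩
        have := h1 (k - 1 - l) (by omega) t htQ
        rwa [show k - 1 - (k - 1 - l) = l by omega] at this
      rw [h0]; exact zero_le
    · push Not at hno
      obtain ⟨l, hl2, hlk, hl⟩ := hno
      obtain ⟨j, rfl⟩ : ∃ j, l = j + 1 := ⟨l - 1, by omega⟩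
      obtain ⟨K, hK, hsl⟩ := sublevel_aux (fun i => iteratedDeriv (i+1) u) (1 / Real.sqrt ε)
        (ε * (2 * N * w)) (by positivity) (by positivity) j
      have h1 := hsl (Icc x y) ordConnected_Icc
        (fun i hi t ht => hd (i+1) (by omega) t (hsub ht)) (by
          intro t ht
          refine le_trans ?_ (hl t ht)
          have a1 : 2 * N ≤ (2 * N) ^ j := le_self_pow₀ (by linarith) (by omega)
          have a2 : Real.sqrt ε ≤ w ^ j := by
            rw [← hwk]; exact pow_le_pow_of_le_one hw0.le hw1 (by omega)
          have a3 : 2 * N * Real.sqrt ε ≤ (2 * N) ^ j * w ^ j := by gcongr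
          rw [div_div]
          apply one_div_le_one_div_of_le (by positivity)
          rw [mul_pow, mul_pow (2 * N) w]
          calc 2 * N * ε ^ (j+1) = (Real.sqrt ε * ε ^ j) * (2 * N * Real.sqrt ε) := by
                nth_rewrite 1 [pow_succ]
                nth_rewrite 2 [← Real.mul_self_sqrt hε.le]
                ring
            _ ≤ (Real.sqrt ε * ε ^ j) * ((2 * N) ^ j * w ^ j) := by gcongr
            _ = _ := by ring)
      refine (measure_mono ?_).trans (h1.trans (ENNReal.ofReal_le_ofReal ?_))
      · rintro t ⟨⟨ht, ht2⟩, htQ⟩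
        refine ⟨htQ, ?_⟩
        simpa [iteratedDeriv_one] using ht2
      · rw [hM]
        apply mul_le_mul_of_nonneg_right _ (by positivity)
        have : (2:ℝ) ^ (j+1) ≤ 2 ^ k := pow_le_pow_right₀ (by norm_num) (by omega)
        linarith
  have hq : 0 < (b - a) / d0 := div_pos (sub_pos.2 hab) hd0p
  set n := ⌈(b - a) / d0⌉₊ with hn
  have hn0 : 0 < n := Nat.ceil_pos.2 hq
  have hn1 : (b - a) / d0 ≤ n := Nat.le_ceil _
  have hn2 : (n:ℝ) < (b - a) / d0 + 1 := Nat.ceil_lt_add_one hq.le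
  have hnp : (0:ℝ) < n := by exact_mod_cast hn0
  have hdn : (b - a) / n ≤ d0 := by
    rw [div_le_iff₀ hd0p] at hn1
    rw [div_le_iff₀ hnp]; linarith
  have hfin := cover_aux E a b hab n hn0 M (fun t ht => ht.1)
    (fun x y h1 h2 h3 h4 => hloc x y h1 h2 h3 (h4.trans hdn))
  refine hfin.trans (ENNReal.ofReal_le_ofReal ?_)
  have hM0 : 0 ≤ M := by positivity
  calc n * M ≤ ((b - a) / d0 + 1) * M := by gcongr
    _ = 2 ^ (k+1) * N * w * (4 * N ^ 2 * S * (b - a) + ε) := by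
      rw [hM, hd0, pow_succ]; field_simp; ring
    _ ≤ 2 ^ (k+1) * N * w * (2 * (2 * N ^ 2 * S * (b - a) + ε)) := by
      gcongr; linarith
    _ = _ := by ring
end

section
/- Let k ≥ 3 be an integer, S > 0 and N ≥ 1 with 2N²S ≥ 1. There exists ε₀ > 0, depending only on k, S and N, such that for every ε ∈ (0, ε₀), every bounded open interval I, and every function u that is k times continuously differentiable on a neighbourhood of the closure of I with F_ε(u; I) ≤ S, if the set { t ∈ I : |u'(t)| < 1/√ε and |u^{(ℓ)}(t)| < 1/(N ε^ℓ) for all ℓ ∈ {2,…,k−1} } has Lebesgue measure zero, then |I| ≤ 4Sε. -/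
open MeasureTheory Set

lemma sep_points (d : ℝ) (hd : 0 < d) (n : ℕ) : ∀ B : Set ℝ, BddBelow B →
    ENNReal.ofReal (n * (2 * d)) < volume B →
    ∃ x : ℕ → ℝ, (∀ i < n, x i ∈ B) ∧ ∀ i, i + 1 < n → x i + d ≤ x (i + 1) := by
  induction n with
  | zero => intro B _ _; exact ⟨fun _ => 0, by simp, by simp⟩
  | succ n ih =>
    intro B hB hv
    have hne : B.Nonempty := by
      rw [nonempty_iff_ne_empty]
      rintro rfl
      simp at hv
    obtain ⟨x0, hx0, hlt⟩ := exists_lt_of_csInf_lt hne (show sInf B < sInf B + d by linarith)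
    have hsub : B ⊆ Icc (sInf B) (sInf B + 2 * d) ∪ (B ∩ Ioi (x0 + d)) := by
      intro y hy
      by_cases h : x0 + d < y
      · exact Or.inr ⟨hy, h⟩
      · exact Or.inl ⟨csInf_le hB hy, by linarith [not_lt.mp h]⟩
    have h1 : volume B ≤ ENNReal.ofReal (2 * d) + volume (B ∩ Ioi (x0 + d)) := by
      refine (measure_mono hsub).trans ((measure_union_le _ _).trans ?_)
      rw [Real.volume_Icc]; simp
    have h2 : ENNReal.ofReal (n * (2 * d)) < volume (B ∩ Ioi (x0 + d)) := by
      have h3 := hv.trans_le h1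
      have : ((n + 1 : ℕ) : ℝ) * (2 * d) = 2 * d + n * (2 * d) := by push_cast; ring
      rw [this, ENNReal.ofReal_add (by positivity) (by positivity)] at h3
      exact lt_of_add_lt_add_left h3
    obtain ⟨x, hx, hs⟩ := ih _ (hB.mono inter_subset_left) h2
    refine ⟨fun i => Nat.casesOn i x0 x, ?_, ?_⟩
    · intro i hi
      cases i with
      | zero => exact hx0
      | succ i => exact (hx i (by omega)).1
    · intro i hi
      cases i with
      | zero => exact (hx 0 (by omega)).2.le
      | succ i => exact hs i (by omega)

lemma rolle_iter (d c e : ℝ) (hd : 0 < d) (j : ℕ) : ∀ (G : ℕ → ℝ → ℝ) (δ : ℝ) (x : ℕ → ℝ),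
    (∀ i < j, ∀ s ∈ Icc c e, HasDerivAt (G i) (G (i + 1) s) s) →
    (∀ i < 2 ^ j, x i ∈ Icc c e ∧ |G 0 (x i)| ≤ δ) →
    (∀ i, i + 1 < 2 ^ j → x i + d ≤ x (i + 1)) →
    ∃ ξ ∈ Icc c e, |G j ξ| ≤ (2 / d) ^ j * δ := by
  induction j with
  | zero => intro G δ x _ hx _; exact ⟨x 0, (hx 0 (by simp)).1, by simpa using (hx 0 (by simp)).2⟩
  | succ j ih =>
    intro G δ x hG hx hs
    have key : ∀ i, ∃ y, i < 2 ^ j → y ∈ Ioo (x (2 * i)) (x (2 * i + 1)) ∧ |G 1 y| ≤ 2 / d * δ := by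
      intro i
      by_cases hi : i < 2 ^ j
      swap
      · exact ⟨0, fun h => absurd h hi⟩
      have hp : 2 ^ (j + 1) = 2 * 2 ^ j := by ring
      have hxa := hx (2 * i) (by omega)
      have hxb := hx (2 * i + 1) (by omega)
      have hss := hs (2 * i) (by omega)
      have hsub : Icc (x (2 * i)) (x (2 * i + 1)) ⊆ Icc c e := Icc_subset_Icc hxa.1.1 hxb.1.2
      obtain ⟨y, hy, hyd⟩ := exists_hasDerivAt_eq_slope (G 0) (G 1)
        (show x (2 * i) < x (2 * i + 1) by linarith)
        (fun s h => (hG 0 (by omega) s (hsub h)).continuousAt.continuousWithinAt)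
        (fun s h => hG 0 (by omega) s (hsub (Ioo_subset_Icc_self h)))
      refine ⟨y, fun _ => ⟨hy, ?_⟩⟩
      rw [hyd, abs_div, abs_of_pos (show 0 < x (2 * i + 1) - x (2 * i) by linarith)]
      have h1 : |G 0 (x (2 * i + 1)) - G 0 (x (2 * i))| ≤ 2 * δ := by
        have := abs_sub (G 0 (x (2 * i + 1))) (G 0 (x (2 * i)))
        linarith [hxa.2, hxb.2]
      have h2 : 0 ≤ 2 * δ := (abs_nonneg _).trans h1
      calc _ ≤ 2 * δ / d := by
            apply div_le_div₀ h2 h1 hd; linarith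
        _ = _ := by ring
    choose y hy using key
    have hp : 2 ^ (j + 1) = 2 * 2 ^ j := by ring
    obtain ⟨ξ, h1, h2⟩ := ih (fun i => G (i + 1)) (2 / d * δ) y
      (fun i hi => hG (i + 1) (by omega))
      (fun i hi => ⟨⟨(hx (2 * i) (by omega)).1.1.trans (hy i hi).1.1.le,
        (hy i hi).1.2.le.trans (hx (2 * i + 1) (by omega)).1.2⟩, (hy i hi).2⟩)
      (fun i hi => by
        have a1 := (hy i (by omega)).1.2
        have a2 := (hy (i + 1) (by omega)).1.1
        have a3 := hs (2 * i + 1) (by omega)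
        have : 2 * (i + 1) = 2 * i + 1 + 1 := by ring
        rw [this] at a2
        linarith)
    exact ⟨ξ, h1, h2.trans_eq (by ring)⟩

lemma bisect (A : Set ℝ) (L : ℝ) (hL : 0 < L)
    (hA : ENNReal.ofReal (3 / 4 * L) ≤ volume (A ∩ Icc 0 L)) (n : ℕ) :
    ∃ c, 0 ≤ c ∧ c + L / 2 ^ n ≤ L ∧
      ENNReal.ofReal (3 / 4 * (L / 2 ^ n)) ≤ volume (A ∩ Icc c (c + L / 2 ^ n)) := by
  induction n with
  | zero => exact ⟨0, le_rfl, by simp, by simpa using hA⟩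
  | succ n ih =>
    obtain ⟨c, h0, h1, h2⟩ := ih
    set h := L / 2 ^ (n + 1) with hh
    have hp : 0 < h := by positivity
    have he : L / 2 ^ n = h + h := by rw [hh]; field_simp; ring
    rw [he] at h1 h2
    by_contra! hcon
    have c1 := hcon c h0 (by linarith)
    have c2 := hcon (c + h) (by linarith) (by linarith)
    have hsub : A ∩ Icc c (c + (h + h)) ⊆ (A ∩ Icc c (c + h)) ∪ (A ∩ Icc (c + h) (c + h + h)) := by
      rintro y ⟨hy, hy1, hy2⟩
      rcases le_total y (c + h) with h | h
      · exact Or.inl ⟨hy, hy1, h⟩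
      · exact Or.inr ⟨hy, h, by linarith⟩
    have := (h2.trans (measure_mono hsub)).trans (measure_union_le _ _)
    have h3 := this.trans_lt (ENNReal.add_lt_add c1 c2)
    rw [← ENNReal.ofReal_add (by positivity) (by positivity)] at h3
    exact absurd h3 (by rw [mul_add]; exact lt_irrefl _)

lemma core (m : ℕ) (hm : 1 ≤ m) (S N : ℝ) (hS : 0 < S) (hN : 1 ≤ N) :
    ∃ ε₀ : ℝ, 0 < ε₀ ∧ ∀ δ, 0 < δ → δ < ε₀ → ∀ G : ℕ → ℝ → ℝ,
      (∀ j < m, ∀ s ∈ Icc 0 (4 * S), HasDerivAt (G j) (G (j + 1) s) s) →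
      ContinuousOn (G m) (Icc 0 (4 * S)) →
      (∫ s in (0:ℝ)..(4 * S), (G m s) ^ 2) ≤ S →
      ENNReal.ofReal (3 / 4 * (4 * S)) ≤ volume ({s | |G 0 s| < δ} ∩ Icc 0 (4 * S)) →
      ∃ s ∈ Icc 0 (4 * S), |G 0 s| < δ ∧ ∀ j, j < m → |G j s| < 1 / N := by
  have hN0 : 0 < N := by linarith
  obtain ⟨n, hn⟩ := pow_unbounded_of_one_lt (4 * S + 4 * S * (4 * N ^ 2 * S)) (one_lt_two : (1:ℝ) < 2)
  obtain ⟨h, hh⟩ : ∃ h, h = 4 * S / 2 ^ n := ⟨_, rfl⟩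
  have h2n : (0:ℝ) < 2 ^ n := by positivity
  have hpos : 0 < h := by rw [hh]; positivity
  have hle1 : h ≤ 1 := by
    rw [hh, div_le_one h2n]
    have : 0 < 4 * S * (4 * N ^ 2 * S) := by positivity
    linarith
  have hle2 : h * (4 * N ^ 2 * S) ≤ 1 := by
    rw [hh, div_mul_eq_mul_div, div_le_one h2n]
    linarith
  obtain ⟨d, hd⟩ : ∃ d, d = h / (4 * 2 ^ m) := ⟨_, rfl⟩
  have hdpos : 0 < d := by rw [hd]; positivity
  have hd1 : 1 ≤ 2 / d := by
    rw [le_div_iff₀ hdpos, hd, one_mul, div_le_iff₀ (by positivity)]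
    have : (1:ℝ) ≤ 2 ^ m := one_le_pow₀ (by norm_num)
    linarith
  obtain ⟨K, hK⟩ : ∃ K, K = (2 / d) ^ m := ⟨_, rfl⟩
  have hKpos : 0 < K := by rw [hK]; positivity
  have hm0 : (0:ℝ) < m := by exact_mod_cast hm
  refine ⟨1 / (2 * N * m * K), by positivity, ?_⟩
  intro δ hδ hδ' G hG hcont hint hA
  have hδK : m * (K * δ) < 1 / (2 * N) := by
    rw [lt_div_iff₀ (by positivity)] at hδ' ⊢
    linarith
  obtain ⟨c, hc0, hc1, hv⟩ := bisect _ _ (by positivity) hA n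
  rw [← hh] at hc1 hv
  have hsub : Icc c (c + h) ⊆ Icc 0 (4 * S) := Icc_subset_Icc hc0 hc1
  obtain ⟨x, hx, hs⟩ := sep_points d hdpos (2 ^ m) _ (bddBelow_Icc.mono inter_subset_right)
    (lt_of_lt_of_le ((ENNReal.ofReal_lt_ofReal_iff (by positivity)).2 (by
      have : ((2 ^ m : ℕ) : ℝ) * (2 * d) = h / 2 := by rw [hd]; push_cast; field_simp; norm_num
      rw [this]; linarith)) hv)
  have hξ : ∀ j < m, ∃ ξ ∈ Icc c (c + h), |G j ξ| ≤ K * δ := by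
    intro j hj
    have hp : 2 ^ j ≤ 2 ^ m := Nat.pow_le_pow_right (by norm_num) hj.le
    obtain ⟨ξ, h1, h2⟩ := rolle_iter d c (c + h) hdpos j G δ x
      (fun i hi s h => hG i (by omega) s (hsub h))
      (fun i hi => ⟨(hx i (by omega)).2, le_of_lt (hx i (by omega)).1⟩)
      (fun i hi => hs i (by omega))
    refine ⟨ξ, h1, h2.trans ?_⟩
    rw [hK]
    gcongr
  have hosc : ∀ x ∈ Icc c (c + h), ∀ y ∈ Icc c (c + h), x ≤ y →
      |G (m - 1) y - G (m - 1) x| ≤ 1 / (2 * N) := by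
    intro x hx y hy hxy
    have hxysub : Icc x y ⊆ Icc 0 (4 * S) := (Icc_subset_Icc hx.1 hy.2).trans hsub
    have hm1 : m - 1 + 1 = m := by omega
    have hci : ContinuousOn (G m) (uIcc x y) := by rw [uIcc_of_le hxy]; exact hcont.mono hxysub
    have hftc : ∫ s in x..y, G m s = G (m - 1) y - G (m - 1) x := by
      apply intervalIntegral.integral_eq_sub_of_hasDerivAt
      · intro s hs
        rw [uIcc_of_le hxy] at hs
        have := hG (m - 1) (by omega) s (hxysub hs)
        rwa [hm1] at this
      · exact hci.intervalIntegrable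
    rw [← hftc]
    have h4S : (0:ℝ) ≤ 4 * S := by positivity
    calc |∫ s in x..y, G m s| ≤ ∫ s in x..y, |G m s| :=
          intervalIntegral.abs_integral_le_integral_abs hxy
      _ ≤ ∫ s in x..y, (1 / (4 * N * S) * (G m s) ^ 2 + N * S) := by
          apply intervalIntegral.integral_mono_on hxy hci.abs.intervalIntegrable
          · exact ContinuousOn.intervalIntegrable (by fun_prop)
          · intro s _
            have : 1 / (4 * N * S) * (G m s) ^ 2 + N * S - |G m s| =
              1 / (4 * N * S) * (|G m s| - 2 * N * S) ^ 2 := by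
              rw [← sq_abs (G m s)]; field_simp; ring
            have h2 : 0 ≤ 1 / (4 * N * S) * (|G m s| - 2 * N * S) ^ 2 := by positivity
            linarith
      _ = 1 / (4 * N * S) * (∫ s in x..y, (G m s) ^ 2) + (y - x) * (N * S) := by
          rw [intervalIntegral.integral_add, intervalIntegral.integral_const_mul,
            intervalIntegral.integral_const, smul_eq_mul]
          · exact ContinuousOn.intervalIntegrable (by fun_prop)
          · exact ContinuousOn.intervalIntegrable (by fun_prop)
      _ ≤ 1 / (4 * N * S) * S + h * (N * S) := by
          gcongr
          · refine le_trans ?_ hint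
            apply intervalIntegral.integral_mono_interval (hxysub ⟨le_rfl, hxy⟩).1 hxy
              (hxysub ⟨hxy, le_rfl⟩).2
            · exact Filter.Eventually.of_forall fun s => sq_nonneg _
            · apply ContinuousOn.intervalIntegrable
              rw [uIcc_of_le h4S]; fun_prop
          · linarith [hx.1, hy.2]
      _ ≤ 1 / (2 * N) := by
          have e1 : 1 / (4 * N * S) * S = 1 / (4 * N) := by field_simp
          have e2 : h * (N * S) ≤ 1 / (4 * N) := by
            rw [le_div_iff₀ (by positivity)]; linarith
          have e3 : 1 / (2 * N) = 1 / (4 * N) + 1 / (4 * N) := by field_simp; norm_num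
          linarith
  have hsup : ∀ i < m, ∀ s ∈ Icc c (c + h),
      |G (m - 1 - i) s| ≤ ((i + 1 : ℕ) : ℝ) * (K * δ) + 1 / (2 * N) := by
    intro i
    induction i with
    | zero =>
      intro _ s hs
      obtain ⟨ξ, h1, h2⟩ := hξ (m - 1) (by omega)
      have h3 : |G (m - 1) s - G (m - 1) ξ| ≤ 1 / (2 * N) := by
        rcases le_total ξ s with h | h
        · exact hosc _ h1 _ hs h
        · rw [abs_sub_comm]; exact hosc _ hs _ h1 h
      have := abs_sub_abs_le_abs_sub (G (m - 1) s) (G (m - 1) ξ)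
      simp only [Nat.sub_zero, zero_add, Nat.cast_one, one_mul]
      linarith
    | succ i ih =>
      intro hi s hs
      obtain ⟨ξ, h1, h2⟩ := hξ (m - 1 - (i + 1)) (by omega)
      have hb := ih (by omega)
      have e : m - 1 - i = m - 1 - (i + 1) + 1 := by omega
      rw [e] at hb
      have h3 := (convex_Icc c (c + h)).norm_image_sub_le_of_norm_hasDerivWithin_le
        (fun s h => (hG (m - 1 - (i + 1)) (by omega) s (hsub h)).hasDerivWithinAt) hb h1 hs
      simp only [Real.norm_eq_abs] at h3
      have h4 : |s - ξ| ≤ 1 := by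
        rw [abs_le]; constructor <;> linarith [hs.1, hs.2, h1.1, h1.2]
      have h5 : 0 ≤ ((i + 1 : ℕ) : ℝ) * (K * δ) + 1 / (2 * N) := by positivity
      have h6 := h3.trans (mul_le_of_le_one_right h5 h4)
      have := abs_sub_abs_le_abs_sub (G (m - 1 - (i + 1)) s) (G (m - 1 - (i + 1)) ξ)
      push_cast at h6 ⊢
      linarith
  have hx0 := hx 0 (by positivity)
  refine ⟨x 0, hsub hx0.2, hx0.1, fun j hj => ?_⟩
  have := hsup (m - 1 - j) (by omega) (x 0) hx0.2
  rw [show m - 1 - (m - 1 - j) = j by omega] at this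
  have h7 : ((m - 1 - j + 1 : ℕ) : ℝ) * (K * δ) ≤ m * (K * δ) := by
    gcongr; omega
  have e3 : 1 / N = 1 / (2 * N) + 1 / (2 * N) := by field_simp; norm_num
  linarith

theorem length_bound_away_from_good_set (k : ℕ) (hk : 3 ≤ k) (S : ℝ) (hS : 0 < S)
    (N : ℝ) (hN : 1 ≤ N) (hNS : 1 ≤ 2 * N ^ 2 * S) :
    ∃ ε₀ : ℝ, 0 < ε₀ ∧
      ∀ ε ∈ Ioo (0:ℝ) ε₀, ∀ a b : ℝ, a < b →
      ∀ u : ℝ → ℝ, (∃ U : Set ℝ, IsOpen U ∧ Icc a b ⊆ U ∧ ContDiffOn ℝ k u U) →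
      Fe k ε u a b ≤ S →
      volume {t ∈ Ioo a b | |deriv u t| < 1 / Real.sqrt ε ∧
        ∀ ℓ : ℕ, 2 ≤ ℓ → ℓ ≤ k - 1 → |iteratedDeriv ℓ u t| < 1 / (N * ε ^ ℓ)} = 0 →
      b - a ≤ 4 * S * ε := by
  obtain ⟨m, rfl⟩ : ∃ m, k = m + 1 := ⟨k - 1, by omega⟩
  obtain ⟨η, hη, hcore⟩ := core m (by omega) S N hS hN
  refine ⟨η ^ 2, by positivity, ?_⟩
  rintro ε ⟨hε, hεη⟩ a b hab u ⟨U, hU, hIU, hu⟩ hF hnull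
  by_contra! hlong
  have hN0 : 0 < N := by linarith
  have hδ : 0 < Real.sqrt ε := Real.sqrt_pos.2 hε
  have hδ2 : Real.sqrt ε * Real.sqrt ε = ε := Real.mul_self_sqrt hε.le
  have hδη : Real.sqrt ε < η := (Real.sqrt_lt' hη).2 hεη
  have hcontU : ∀ j ≤ m + 1, ContinuousOn (iteratedDeriv j u) U := by
    intro j hj
    refine (hu.continuousOn_iteratedDerivWithin (m := j) (by exact_mod_cast hj)
      hU.uniqueDiffOn).congr ?_
    exact (iteratedDerivWithin_of_isOpen hU).symm
  have hder : ∀ j < m + 1, ∀ t ∈ U, HasDerivAt (iteratedDeriv j u) (iteratedDeriv (j + 1) u t) t := by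
    intro j hj t ht
    have h1 : DifferentiableOn ℝ (iteratedDeriv j u) U :=
      (hu.differentiableOn_iteratedDerivWithin (m := j) (by exact_mod_cast hj)
      hU.uniqueDiffOn).congr (iteratedDerivWithin_of_isOpen hU).symm
    rw [iteratedDeriv_succ]
    exact (h1.differentiableAt (hU.mem_nhds ht)).hasDerivAt
  have hd1 : deriv u = iteratedDeriv 1 u := iteratedDeriv_one.symm
  rw [hd1] at hnull
  unfold Fe at hF
  rw [hd1, ← integral_Ioc_eq_integral_Ioo, ← integral_Ioc_eq_integral_Ioo,
    ← intervalIntegral.integral_of_le hab.le, ← intervalIntegral.integral_of_le hab.le] at hF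
  have hc1 : ContinuousOn (iteratedDeriv 1 u) (Icc a b) := (hcontU 1 (by omega)).mono hIU
  have hck : ContinuousOn (iteratedDeriv (m + 1) u) (Icc a b) := (hcontU _ le_rfl).mono hIU
  have hi1 : IntervalIntegrable (fun t => min ((iteratedDeriv 1 u t) ^ 2) (1 / ε)) volume a b := by
    apply ContinuousOn.intervalIntegrable
    rw [uIcc_of_le hab.le]
    exact ContinuousOn.inf (hc1.pow 2) continuousOn_const
  have hik : IntervalIntegrable (fun t => (iteratedDeriv (m + 1) u t) ^ 2) volume a b := by
    apply ContinuousOn.intervalIntegrable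
    rw [uIcc_of_le hab.le]
    exact hck.pow 2
  have hnn1 : ∀ t, 0 ≤ min ((iteratedDeriv 1 u t) ^ 2) (1 / ε) := fun t => by positivity
  have hnnk : ∀ t, 0 ≤ (iteratedDeriv (m + 1) u t) ^ 2 := fun t => by positivity
  have hbe : a + ε * (4 * S) ≤ b := by linarith
  have hae : a ≤ a + ε * (4 * S) := by have : 0 < ε * (4 * S) := by positivity
                                       linarith
  have hm1 := intervalIntegral.integral_mono_interval le_rfl hae hbe
    (Filter.Eventually.of_forall hnn1) hi1
  have hmk := intervalIntegral.integral_mono_interval le_rfl hae hbe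
    (Filter.Eventually.of_forall hnnk) hik
  have hp1 := intervalIntegral.integral_nonneg hab.le (fun t _ => hnn1 t) (μ := volume)
  have hpk := intervalIntegral.integral_nonneg hab.le (fun t _ => hnnk t) (μ := volume)
  have hεk : 0 < ε ^ (2 * (m + 1) - 1) := by positivity
  have hE1 : ∫ t in a..(a + ε * (4 * S)), min ((iteratedDeriv 1 u t) ^ 2) (1 / ε) ≤ S := by
    have := mul_nonneg hεk.le hpk
    linarith
  have hEk : ε ^ (2 * (m + 1) - 1) *
      ∫ t in a..(a + ε * (4 * S)), (iteratedDeriv (m + 1) u t) ^ 2 ≤ S := by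
    have := mul_le_mul_of_nonneg_left hmk hεk.le
    linarith
  have hmaps : ∀ s ∈ Icc 0 (4 * S), a + ε * s ∈ Icc a b := by
    intro s hs
    have h1 := mul_nonneg hε.le hs.1
    have h2 := mul_le_mul_of_nonneg_left hs.2 hε.le
    exact ⟨by linarith, by linarith⟩
  have hS4 : (0:ℝ) ≤ 4 * S := by positivity
  have haff : ContinuousOn (fun s : ℝ => a + ε * s) (Icc 0 (4 * S)) := by fun_prop
  obtain ⟨s, hs, hs0, hsj⟩ := hcore (Real.sqrt ε) hδ hδη
    (fun j s => ε ^ (j + 1) * iteratedDeriv (j + 1) u (a + ε * s))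
    (by
      intro j hj s hs
      have h1 : HasDerivAt (fun s : ℝ => a + ε * s) ε s := by
        simpa using ((hasDerivAt_id s).const_mul ε).const_add a
      have h2 := (hder (j + 1) (by omega) _ (hIU (hmaps s hs))).comp s h1
      refine (h2.const_mul (ε ^ (j + 1))).congr_deriv ?_
      ring)
    (by exact continuousOn_const.mul (hck.comp haff hmaps))
    (by
      have e : ∀ s, (ε ^ (m + 1) * iteratedDeriv (m + 1) u (a + ε * s)) ^ 2 =
          (fun t => (ε ^ (m + 1)) ^ 2 * (iteratedDeriv (m + 1) u t) ^ 2) (a + ε * s) :=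
        fun s => by simp only; ring
      simp_rw [e]
      rw [intervalIntegral.integral_comp_add_mul (fun t => (ε ^ (m + 1)) ^ 2 * (iteratedDeriv (m + 1) u t) ^ 2) hε.ne',
        intervalIntegral.integral_const_mul, smul_eq_mul, mul_zero, add_zero, ← mul_assoc]
      have e2 : ε⁻¹ * (ε ^ (m + 1)) ^ 2 = ε ^ (2 * (m + 1) - 1) := by
        rw [show 2 * (m + 1) - 1 = 2 * m + 1 by omega]
        field_simp
        ring
      rw [e2]
      exact hEk)
    (by
      have hcm : ContinuousOn (fun s => min (ε * (iteratedDeriv 1 u (a + ε * s)) ^ 2) 1)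
          (Icc 0 (4 * S)) :=
        ContinuousOn.inf (continuousOn_const.mul ((hc1.comp haff hmaps).pow 2)) continuousOn_const
      have hmk := mul_meas_ge_le_integral_of_nonneg
        (μ := volume.restrict (Icc 0 (4 * S)))
        (f := fun s => min (ε * (iteratedDeriv 1 u (a + ε * s)) ^ 2) 1)
        (Filter.Eventually.of_forall fun s => by
          simp only [Pi.zero_apply]; positivity)
        (hcm.integrableOn_compact isCompact_Icc) 1
      have hint : ∫ s in Icc 0 (4 * S), min (ε * (iteratedDeriv 1 u (a + ε * s)) ^ 2) 1 ≤ S := by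
        rw [integral_Icc_eq_integral_Ioc, ← intervalIntegral.integral_of_le hS4]
        have e : ∀ s, min (ε * (iteratedDeriv 1 u (a + ε * s)) ^ 2) 1 =
          (fun t => ε * min ((iteratedDeriv 1 u t) ^ 2) (1 / ε)) (a + ε * s) := fun s => by
          simp only
          rw [mul_min_of_nonneg _ _ hε.le, mul_one_div_cancel hε.ne']
        simp_rw [e]
        rw [intervalIntegral.integral_comp_add_mul (fun t => ε * min ((iteratedDeriv 1 u t) ^ 2) (1 / ε)) hε.ne',
          intervalIntegral.integral_const_mul, smul_eq_mul, mul_zero, add_zero,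
          inv_mul_cancel_left₀ hε.ne']
        exact hE1
      rw [one_mul] at hmk
      have hC := hmk.trans hint
      rw [measureReal_restrict_apply' measurableSet_Icc] at hC
      have hC' := ENNReal.ofReal_le_ofReal hC
      rw [ofReal_measureReal (measure_inter_lt_top_of_right_ne_top isCompact_Icc.measure_lt_top.ne).ne] at hC'
      set A := {s | |ε ^ (0 + 1) * iteratedDeriv (0 + 1) u (a + ε * s)| < √ε} ∩ Icc 0 (4 * S)
      have hsub : Icc 0 (4 * S) ⊆ A ∪
          ({x | 1 ≤ min (ε * iteratedDeriv 1 u (a + ε * x) ^ 2) 1} ∩ Icc 0 (4 * S)) := by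
        intro s hs
        by_cases h : |ε ^ (0 + 1) * iteratedDeriv (0 + 1) u (a + ε * s)| < √ε
        · exact Or.inl ⟨h, hs⟩
        · refine Or.inr ⟨?_, hs⟩
          rw [mem_setOf_eq]
          refine le_min ?_ le_rfl
          simp only [zero_add, pow_one, not_lt, abs_mul, abs_of_pos hε] at h
          have h1 : 1 ≤ √ε * |iteratedDeriv 1 u (a + ε * s)| := by
            nth_rewrite 2 [← hδ2] at h
            rw [mul_assoc] at h
            exact (le_mul_iff_one_le_right hδ).1 h
          have h2 := one_le_pow₀ h1 (n := 2)
          rw [mul_pow, sq_abs, Real.sq_sqrt hε.le] at h2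
          exact h2
      have h4 := (measure_mono hsub).trans (measure_union_le (μ := volume) _ _)
      have h5 := h4.trans (add_le_add_right hC' _)
      rw [Real.volume_Icc, show 4 * S - 0 = 3 / 4 * (4 * S) + S by ring,
        ENNReal.ofReal_add (by positivity) hS.le] at h5
      exact (ENNReal.add_le_add_iff_right (by simp)).1 h5)
  set t := a + ε * s with ht
  have htI := hmaps s hs
  have htU := hIU htI
  have hca : ∀ j ≤ m + 1, ContinuousAt (iteratedDeriv j u) t :=
    fun j hj => (hcontU j hj).continuousAt (hU.mem_nhds htU)
  have ev1 : ∀ᶠ x in nhds t, |iteratedDeriv 1 u x| < 1 / √ε := by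
    apply (hca 1 (by omega)).abs.eventually_lt continuousAt_const
    simp only [zero_add, pow_one, abs_mul, abs_of_pos hε] at hs0
    rw [lt_div_iff₀ hδ]
    nth_rewrite 1 [← hδ2] at hs0
    have : √ε * (|iteratedDeriv 1 u t| * √ε) < √ε * 1 := by linarith
    exact lt_of_mul_lt_mul_left this hδ.le
  have ev2 : ∀ᶠ x in nhds t, ∀ ℓ ∈ Finset.Icc 2 m, |iteratedDeriv ℓ u x| < 1 / (N * ε ^ ℓ) := by
    rw [Finset.eventually_all]
    intro ℓ hℓ
    rw [Finset.mem_Icc] at hℓ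
    apply (hca ℓ (by omega)).abs.eventually_lt continuousAt_const
    have := hsj (ℓ - 1) (by omega)
    simp only [show ℓ - 1 + 1 = ℓ by omega, abs_mul, abs_of_pos (pow_pos hε ℓ)] at this
    rw [lt_div_iff₀ (by positivity)] at this ⊢
    linarith
  obtain ⟨V, hV, hVo, htV⟩ := eventually_nhds_iff.1 (ev1.and ev2)
  have hne : (V ∩ Ioo a b).Nonempty := by
    rw [← closure_Ioo hab.ne] at htI
    exact mem_closure_iff.1 htI V hVo htV
  have hpos := (hVo.inter isOpen_Ioo).measure_pos volume hne
  refine absurd hnull (ne_of_gt (hpos.trans_le (measure_mono ?_)))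
  rintro x ⟨hxV, hxI⟩
  exact ⟨hxI, (hV x hxV).1, fun ℓ h1 h2 => (hV x hxV).2 ℓ (Finset.mem_Icc.2 ⟨h1, by omega⟩)⟩
end
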